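/- Fix 0<c<∞, an integer d≥3, and an integer K≥1. There exist ε>0, δ>0, and α>0 depending only on c, d, K such that for all n sufficiently large, for the KCIP on Λ(L,d) with p=c/n, uniformly over 1 ≤ k ≤ K and initial configurations x∈Ω_k: P[ Σ_{t=0}^{⌊εn³⌋} 1{X_t∈Ω_k} ≥ α·n³ | X_0 = x ] ≥ δ. -/

import Mathlib

open scoped Classical
open Finset

noncomputable section

/-- The number of particles (vertices labelled `1`) of a configuration. -/
def numParticles {V : Type*} [Fintype V] (x : V → Bool) : ℕ :=
  (Finset.univ.filter fun v => x v = true).card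

/-- One-step transition kernel of the kinetically constrained Ising process (KCIP)
on the graph `G` with density parameter `p`: a uniformly chosen vertex `v` is updated,
and its label is resampled (to `1` with probability `p`, to `0` otherwise) iff `v` has at
least one neighbour labelled `1`. -/
def kcipKernel {V : Type*} [Fintype V] (G : SimpleGraph V) (p : ℝ) (x y : V → Bool) : ℝ :=
  ((Fintype.card V : ℝ))⁻¹ * ∑ v : V,
    (if ∀ w, w ≠ v → y w = x w then
      (if ∃ u, G.Adj u v ∧ x u = true then (if y v = true then p else 1 - p)
       else (if y v = x v then 1 else 0))
     else 0)

/-- Probability that the Markov chain with kernel `K` started at `x` produces a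
trajectory `(X_0, …, X_T)` lying in the event `A`. -/
def trajProb {Ω : Type*} [Fintype Ω] (K : Ω → Ω → ℝ) (x : Ω) (T : ℕ)
    (A : (Fin (T + 1) → Ω) → Prop) : ℝ :=
  ∑ ω : Fin (T + 1) → Ω,
    if ω 0 = x ∧ A ω then ∏ i : Fin T, K (ω i.castSucc) (ω i.succ) else 0

/-- Expectation of a functional `f` of the trajectory `(X_0, …, X_T)` of the Markov chain
with kernel `K` started at `x`. -/
def trajExp {Ω : Type*} [Fintype Ω] (K : Ω → Ω → ℝ) (x : Ω) (T : ℕ)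
    (f : (Fin (T + 1) → Ω) → ℝ) : ℝ :=
  ∑ ω : Fin (T + 1) → Ω,
    (if ω 0 = x then ∏ i : Fin T, K (ω i.castSucc) (ω i.succ) else 0) * f ω

/-- The `d`-dimensional discrete torus `Z_L^d`: vertices are `Fin d → ZMod L`, with an edge
between `u` and `v` iff `u - v = ± e_i` for some coordinate vector `e_i`. -/
def torusGraph (L d : ℕ) : SimpleGraph (Fin d → ZMod L) :=
  SimpleGraph.fromRel fun u v => ∃ i : Fin d, v = u + fun j => if j = i then (1 : ZMod L) else 0

/-- `Ω_k`: configurations with exactly `k` particles, no two of which are adjacent. -/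
def OmegaK {V : Type*} [Fintype V] (G : SimpleGraph V) (k : ℕ) : Set (V → Bool) :=
  {x | numParticles x = k ∧ ∀ u v, G.Adj u v → ¬(x u = true ∧ x v = true)}

/-! ### Occupation probabilities of a finite Markov chain -/

theorem trajProb_zero {Ω : Type*} [Fintype Ω] (K : Ω → Ω → ℝ) (x : Ω)
    (A : (Fin (0 + 1) → Ω) → Prop) :
    trajProb K x 0 A = if A (fun _ => x) then 1 else 0 := by
  unfold trajProb
  rw [Fintype.sum_eq_single (fun _ => x)]
  · simp
  · intro ω hω
    rw [if_neg]
    rintro ⟨h0, -⟩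
    apply hω
    funext i
    rw [show i = 0 from Fin.ext (by omega), h0]

theorem trajProb_succ {Ω : Type*} [Fintype Ω] (K : Ω → Ω → ℝ) (x : Ω) (T : ℕ)
    (A : (Fin (T + 1 + 1) → Ω) → Prop) :
    trajProb K x (T + 1) A =
      ∑ y, K x y * trajProb K y T (fun ω => A (Fin.cons x ω : Fin (T + 1 + 1) → Ω)) := by
  unfold trajProb
  rw [← (Fin.consEquiv (fun _ : Fin (T + 1 + 1) => Ω)).sum_comp, Fintype.sum_prod_type,
    Fintype.sum_eq_single x]
  · simp_rw [Finset.mul_sum]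
    rw [Finset.sum_comm]
    refine Finset.sum_congr rfl fun ω _ => ?_
    rw [Fintype.sum_eq_single (ω 0)]
    · simp only [Fin.consEquiv, Equiv.coe_fn_mk, Fin.cons_zero, true_and]
      rw [mul_ite, mul_zero]
      congr 1
      rw [Fin.prod_univ_succ]
      simp
    · intro y hy
      rw [if_neg (fun h => hy h.1.symm), mul_zero]
  · intro y hy
    refine Finset.sum_eq_zero fun ω _ => if_neg ?_
    simp [Fin.consEquiv, hy]

/-- The probability that the chain started at `x` makes at least `a` visits to `S` during the
times `0, …, T`. -/
def occupationProb {Ω : Type*} [Fintype Ω] (K : Ω → Ω → ℝ) (S : Set Ω) (T : ℕ) (a : ℝ)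
    (x : Ω) : ℝ :=
  trajProb K x T fun ω => a ≤ ∑ t : Fin (T + 1), if ω t ∈ S then (1 : ℝ) else 0

theorem occupationProb_zero {Ω : Type*} [Fintype Ω] (K : Ω → Ω → ℝ) (S : Set Ω) (a : ℝ) (x : Ω) :
    occupationProb K S 0 a x = if a ≤ (if x ∈ S then 1 else 0) then 1 else 0 := by
  unfold occupationProb
  rw [trajProb_zero]
  simp

theorem occupationProb_succ {Ω : Type*} [Fintype Ω] (K : Ω → Ω → ℝ) (S : Set Ω) (T : ℕ) (a : ℝ)
    (x : Ω) :
    occupationProb K S (T + 1) a x =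
      ∑ y, K x y * occupationProb K S T (a - if x ∈ S then 1 else 0) y := by
  unfold occupationProb
  rw [trajProb_succ]
  refine Finset.sum_congr rfl fun y _ => ?_
  congr 2
  funext ω
  rw [Fin.sum_univ_succ]
  simp [add_comm]

theorem occupationProb_nonneg {Ω : Type*} [Fintype Ω] {K : Ω → Ω → ℝ} (hK : ∀ x y, 0 ≤ K x y)
    (S : Set Ω) (T : ℕ) (a : ℝ) (x : Ω) : 0 ≤ occupationProb K S T a x := by
  unfold occupationProb trajProb
  refine Finset.sum_nonneg fun ω _ => ?_
  split_ifs
  · exact Finset.prod_nonneg fun i _ => hK _ _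
  · exact le_rfl

theorem occupationProb_anti {Ω : Type*} [Fintype Ω] {K : Ω → Ω → ℝ} (hK : ∀ x y, 0 ≤ K x y)
    (S : Set Ω) (T : ℕ) {a b : ℝ} (hab : a ≤ b) (x : Ω) :
    occupationProb K S T b x ≤ occupationProb K S T a x := by
  unfold occupationProb trajProb
  refine Finset.sum_le_sum fun ω _ => ?_
  split_ifs with h₁ h₂
  · exact le_rfl
  · exact absurd ⟨h₁.1, hab.trans h₁.2⟩ h₂
  · exact Finset.prod_nonneg fun i _ => hK _ _
  · exact le_rfl

theorem sum_mul_occupationProb_le {Ω : Type*} [Fintype Ω] {K : Ω → Ω → ℝ}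
    (hK : ∀ x y, 0 ≤ K x y) (S : Set Ω) (T : ℕ) (a : ℝ) (x : Ω) :
    ∑ y, K x y * occupationProb K S T a y ≤ occupationProb K S (T + 1) a x := by
  rw [occupationProb_succ]
  refine Finset.sum_le_sum fun y _ => mul_le_mul_of_nonneg_left ?_ (hK x y)
  refine occupationProb_anti hK S T ?_ y
  split_ifs <;> linarith

theorem occupationProb_le_succ {Ω : Type*} [Fintype Ω] {K : Ω → Ω → ℝ}
    (hK : ∀ x y, 0 ≤ K x y) (hK₁ : ∀ x, ∑ y, K x y = 1) (S : Set Ω) (T : ℕ) (a : ℝ) (x : Ω) :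
    occupationProb K S T a x ≤ occupationProb K S (T + 1) a x := by
  induction T generalizing a x with
  | zero =>
    rw [occupationProb_zero]
    by_cases h : a ≤ if x ∈ S then 1 else 0
    · rw [if_pos h, occupationProb_succ]
      refine (hK₁ x).ge.trans
        (Finset.sum_le_sum fun y _ => le_mul_of_one_le_right (hK x y) ?_)
      rw [occupationProb_zero, if_pos]
      refine (sub_nonpos.2 h).trans ?_
      split_ifs <;> norm_num
    · rw [if_neg h]
      exact occupationProb_nonneg hK _ _ _ _
  | succ T ih =>
    rw [occupationProb_succ K S T, occupationProb_succ K S (T + 1)]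
    exact Finset.sum_le_sum fun y _ => mul_le_mul_of_nonneg_left (ih _ y) (hK x y)

theorem occupationProb_mono {Ω : Type*} [Fintype Ω] {K : Ω → Ω → ℝ}
    (hK : ∀ x y, 0 ≤ K x y) (hK₁ : ∀ x, ∑ y, K x y = 1) (S : Set Ω) (a : ℝ) (x : Ω) :
    Monotone fun T => occupationProb K S T a x :=
  monotone_nat_of_le_succ fun T => occupationProb_le_succ hK hK₁ S T a x

/-- A potential `Φ` which increases on average by at most `C` per step, and decreases on average
by at least `1 / b - C` outside of `S`, controls the probability of spending more than
time `b` outside of `S`. -/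
theorem le_occupationProb_of_potential {Ω : Type*} [Fintype Ω] {K : Ω → Ω → ℝ}
    (hK : ∀ x y, 0 ≤ K x y) (hK₁ : ∀ x, ∑ y, K x y = 1) {S : Set Ω} {Φ : Ω → ℝ} {b C : ℝ}
    (hb : 0 < b) (hC : 0 ≤ C) (hΦ : ∀ x, 0 ≤ Φ x) (hΦS : ∀ x, x ∉ S → 1 / b ≤ Φ x)
    (hdrift : ∀ x, Φ x < 1 →
      ∑ y, K x y * Φ y + (if x ∈ S then 0 else 1 / b) ≤ Φ x + C)
    (T : ℕ) (a : ℝ) (ha : T + 1 - a ≤ b) (x : Ω) :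
    (T + 1 - a) / b - Φ x - C * T ≤ occupationProb K S T a x := by
  induction T generalizing a x with
  | zero =>
    rw [occupationProb_zero]
    have h1 : (((0 : ℕ) : ℝ) + 1 - a) / b ≤ 1 := (div_le_one hb).2 ha
    have h2 := hΦ x
    by_cases hx : x ∈ S
    · simp only [hx, if_true]
      split_ifs with h
      · simp only [Nat.cast_zero] at *; linarith
      · have : (((0 : ℕ) : ℝ) + 1 - a) / b ≤ 0 :=
          div_nonpos_of_nonpos_of_nonneg (by push_cast; linarith) hb.le
        simp only [Nat.cast_zero] at *; linarith
    · simp only [hx, if_false]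
      split_ifs with h
      · simp only [Nat.cast_zero] at *; linarith
      · have : (((0 : ℕ) : ℝ) + 1 - a) / b ≤ 1 / b := by
          gcongr
          push_cast; linarith
        have h3 := hΦS x hx
        simp only [Nat.cast_zero] at *; linarith
  | succ T ih =>
    by_cases hx : Φ x < 1
    · rw [occupationProb_succ]
      have ha' : (T : ℝ) + 1 - (a - if x ∈ S then 1 else 0) ≤ b := by
        push_cast at ha
        split_ifs <;> linarith
      have h := Finset.sum_le_sum fun y (_ : y ∈ Finset.univ) =>
        mul_le_mul_of_nonneg_left (ih (a - if x ∈ S then 1 else 0) ha' y) (hK x y)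
      refine le_trans ?_ h
      have hd := hdrift x hx
      have e : ∑ y, K x y * (((T : ℝ) + 1 - (a - if x ∈ S then 1 else 0)) / b - Φ y - C * T)
          = ((T : ℝ) + 1 - (a - if x ∈ S then 1 else 0)) / b - C * T - ∑ y, K x y * Φ y := by
        have : ∀ y, K x y * (((T : ℝ) + 1 - (a - if x ∈ S then 1 else 0)) / b - Φ y - C * T)
          = K x y * (((T : ℝ) + 1 - (a - if x ∈ S then 1 else 0)) / b - C * T) - K x y * Φ y :=
          fun y => by ring
        simp_rw [this]
        rw [Finset.sum_sub_distrib, ← Finset.sum_mul, hK₁, one_mul]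
      rw [e]
      push_cast
      by_cases hS : x ∈ S
      · simp only [hS, if_true] at hd ⊢
        have : (T : ℝ) + 1 + 1 - a = T + 1 - (a - 1) := by ring
        rw [this]
        linarith
      · simp only [hS, if_false] at hd ⊢
        have : ((T : ℝ) + 1 + 1 - a) / b = (T + 1 - (a - 0)) / b + 1 / b := by ring
        rw [this]
        linarith
    · have h1 : (((T + 1 : ℕ) : ℝ) + 1 - a) / b ≤ 1 := (div_le_one hb).2 ha
      have h2 : 0 ≤ C * ((T + 1 : ℕ) : ℝ) := by positivity
      linarith [occupationProb_nonneg hK S (T + 1) a x]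

/-- If the chain jumps from `x` to `y` with probability at least `μ` and holds at `x` with
probability at least `1 - l`, then `m` extra steps suffice to reach `y` with probability
at least `m * μ * (1 - l) ^ m`. -/
theorem mul_le_of_jump {u : ℕ → ℝ} {A μ l : ℝ} (hA : 0 ≤ A) (hμ : 0 ≤ μ) (hl : 0 ≤ l)
    (hl₁ : l ≤ 1) (h0 : 0 ≤ u 0) (hu : ∀ j, (1 - l) * u j + μ * A ≤ u (j + 1)) (m : ℕ) :
    m * μ * (1 - l) ^ m * A ≤ u m := by
  induction m with
  | zero => simpa using h0
  | succ m ih =>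
    refine le_trans ?_ (hu m)
    have h1 : (1 - l) * (m * μ * (1 - l) ^ m * A) ≤ (1 - l) * u m :=
      mul_le_mul_of_nonneg_left ih (by linarith)
    have h2 : (1 - l) ^ (m + 1) ≤ 1 := pow_le_one₀ (by linarith) (by linarith)
    have h3 : μ * A * (1 - l) ^ (m + 1) ≤ μ * A := mul_le_of_le_one_right (by positivity) h2
    calc ((m + 1 : ℕ) : ℝ) * μ * (1 - l) ^ (m + 1) * A
        = (1 - l) * (m * μ * (1 - l) ^ m * A) + μ * A * (1 - l) ^ (m + 1) := by
          push_cast; ring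
      _ ≤ _ := by linarith

theorem exp_le_one_sub_pow {l : ℝ} (hl : 0 ≤ l) (hl₁ : l ≤ 1 / 2) (m : ℕ) :
    Real.exp (-(2 * (m * l))) ≤ (1 - l) ^ m := by
  have h : Real.exp (-(2 * l)) ≤ 1 - l := by
    rw [Real.exp_neg, inv_le_comm₀ (Real.exp_pos _) (by linarith)]
    refine le_trans ?_ (Real.add_one_le_exp _)
    rw [inv_le_iff_one_le_mul₀ (by linarith)]
    nlinarith
  calc Real.exp (-(2 * (m * l))) = Real.exp (-(2 * l)) ^ m := by
        rw [← Real.exp_nat_mul]; ring_nf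
    _ ≤ _ := pow_le_pow_left₀ (Real.exp_pos _).le h m

/-! ### The transition kernel of the KCIP -/

/-- The vertices at which the KCIP may change the configuration `x`. -/
def updatable {V : Type*} [Fintype V] (G : SimpleGraph V) (x : V → Bool) : Finset V :=
  Finset.univ.filter fun v => ∃ u, G.Adj u v ∧ x u = true

theorem sum_kcipKernel_mul {V : Type*} [Fintype V] (G : SimpleGraph V) (p : ℝ) (x : V → Bool)
    (f : (V → Bool) → ℝ) :
    ∑ y, kcipKernel G p x y * f y =
      (Fintype.card V : ℝ)⁻¹ * ∑ v, if v ∈ updatable G x then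
        p * f (Function.update x v true) + (1 - p) * f (Function.update x v false) else f x := by
  unfold kcipKernel
  simp_rw [mul_assoc, ← Finset.mul_sum, Finset.sum_mul]
  rw [Finset.sum_comm]
  congr 1
  refine Finset.sum_congr rfl fun v _ => ?_
  have key : ∀ h : (V → Bool) → ℝ,
      ∑ y : V → Bool, (if ∀ w, w ≠ v → y w = x w then h y else 0) =
        h (Function.update x v true) + h (Function.update x v false) := by
    intro h
    rw [← Finset.sum_filter]
    have : (Finset.univ.filter fun y : V → Bool => ∀ w, w ≠ v → y w = x w) =
        {Function.update x v true, Function.update x v false} := by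
      ext y
      simp only [Finset.mem_filter, Finset.mem_univ, true_and, Finset.mem_insert,
        Finset.mem_singleton]
      constructor
      · intro hy
        have e : y = Function.update x v (y v) := by
          funext w
          by_cases hw : w = v
          · subst hw; simp
          · simp [hw, hy w hw]
        cases hb : y v
        · right; rw [hb] at e; exact e
        · left; rw [hb] at e; exact e
      · rintro (rfl | rfl) w hw <;> simp [hw]
    rw [this, Finset.sum_pair]
    intro h'
    have := congrFun h' v
    simp at this
  simp_rw [ite_mul, zero_mul]
  rw [key]
  simp only [updatable, Finset.mem_filter, Finset.mem_univ, true_and, Function.update_self]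
  have hself : ∀ b, x v = b → Function.update x v b = x := by
    rintro _ rfl
    exact Function.update_eq_self v x
  by_cases h1 : ∃ u, G.Adj u v ∧ x u = true
  · simp [h1]
  · cases hv : x v <;> simp [h1, hself _ hv]

theorem kcipKernel_nonneg {V : Type*} [Fintype V] (G : SimpleGraph V) {p : ℝ} (hp : 0 ≤ p)
    (hp₁ : p ≤ 1) (x y : V → Bool) : 0 ≤ kcipKernel G p x y := by
  unfold kcipKernel
  refine mul_nonneg (by positivity) (Finset.sum_nonneg fun v _ => ?_)
  split_ifs <;> linarith

theorem sum_kcipKernel {V : Type*} [Fintype V] [Nonempty V] (G : SimpleGraph V) (p : ℝ)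
    (x : V → Bool) : ∑ y, kcipKernel G p x y = 1 := by
  have h := sum_kcipKernel_mul G p x fun _ => 1
  simp only [mul_one] at h
  rw [h]
  simp

theorem card_updatable_le {V : Type*} [Fintype V] (G : SimpleGraph V) {D : ℕ}
    (hD : ∀ v, (Finset.univ.filter (G.Adj v)).card ≤ D) (x : V → Bool) :
    (updatable G x).card ≤ numParticles x * D := by
  have : updatable G x ⊆
      (Finset.univ.filter fun v => x v = true).biUnion fun v => Finset.univ.filter (G.Adj v) := by
    intro w hw
    simp only [updatable, Finset.mem_filter, Finset.mem_univ, true_and] at hw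
    obtain ⟨u, hu, hx⟩ := hw
    simp only [Finset.mem_biUnion, Finset.mem_filter, Finset.mem_univ, true_and]
    exact ⟨u, hx, hu⟩
  exact (Finset.card_le_card this).trans (Finset.card_biUnion_le_card_mul _ _ _ fun v _ => hD v)

theorem numParticles_update_true {V : Type*} [Fintype V] {x : V → Bool} {v : V}
    (hv : x v = false) : numParticles (Function.update x v true) = numParticles x + 1 := by
  unfold numParticles
  have : (Finset.univ.filter fun u => Function.update x v true u = true) =
      insert v (Finset.univ.filter fun u => x u = true) := by
    ext u
    by_cases hu : u = v
    · subst hu; simp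
    · simp [hu]
  rw [this, Finset.card_insert_of_notMem (by simp [hv])]

theorem numParticles_update_false {V : Type*} [Fintype V] {x : V → Bool} {v : V}
    (hv : x v = true) : numParticles (Function.update x v false) + 1 = numParticles x := by
  rw [← numParticles_update_true (by simp : Function.update x v false v = false),
    Function.update_idem, ← hv, Function.update_eq_self]

theorem mem_updatable_of_adj {V : Type*} [Fintype V] {G : SimpleGraph V} {x : V → Bool} {u v : V}
    (h : G.Adj u v) (hu : x u = true) : v ∈ updatable G x := by
  simp only [updatable, Finset.mem_filter, Finset.mem_univ, true_and]
  exact ⟨u, h, hu⟩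

theorem eq_false_of_mem_updatable {V : Type*} [Fintype V] {G : SimpleGraph V} {x : V → Bool}
    {k : ℕ} (hx : x ∈ OmegaK G k) {v : V} (hv : v ∈ updatable G x) : x v = false := by
  simp only [updatable, Finset.mem_filter, Finset.mem_univ, true_and] at hv
  obtain ⟨u, hu, hxu⟩ := hv
  exact Bool.eq_false_iff.2 fun h => hx.2 u v hu ⟨hxu, h⟩

/-- The mean of a nonnegative function after one step: one only keeps the steps at which
nothing happens and those at which the vertex `w` is chosen. -/
theorem le_sum_kcipKernel_mul {V : Type*} [Fintype V] [Nonempty V] (G : SimpleGraph V) {p : ℝ}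
    (x : V → Bool) (f : (V → Bool) → ℝ) {r s : ℝ} (hr : 0 ≤ r * f x) {w : V}
    (hs : ∀ v ∈ updatable G x, (1 - r) * f x + (if v = w then s else 0) ≤
      p * f (Function.update x v true) + (1 - p) * f (Function.update x v false))
    (hw : w ∈ updatable G x) {m : ℕ} (hm : (updatable G x).card ≤ m) :
    (1 - r * m / Fintype.card V) * f x + s / Fintype.card V ≤
      ∑ y, kcipKernel G p x y * f y := by
  rw [sum_kcipKernel_mul]
  have hn : (0 : ℝ) < Fintype.card V := by exact_mod_cast Fintype.card_pos
  have h : ∑ v : V, (f x - (if v ∈ updatable G x then r * f x else 0) + if v = w then s else 0) ≤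
      ∑ v, if v ∈ updatable G x then
        p * f (Function.update x v true) + (1 - p) * f (Function.update x v false) else f x := by
    refine Finset.sum_le_sum fun v _ => ?_
    by_cases hv : v ∈ updatable G x
    · simp only [hv, if_true]
      refine le_trans (le_of_eq ?_) (hs v hv)
      ring
    · have : v ≠ w := fun h => hv (h ▸ hw)
      simp [hv, this]
  rw [Finset.sum_add_distrib, Finset.sum_sub_distrib, ← Finset.sum_filter,
    Finset.filter_mem_eq_inter, Finset.univ_inter, Finset.sum_const, Finset.sum_const,
    Finset.sum_ite_eq' Finset.univ w, if_pos (Finset.mem_univ w), nsmul_eq_mul, nsmul_eq_mul,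
    Finset.card_univ] at h
  have h2 : ((updatable G x).card : ℝ) * (r * f x) ≤ m * (r * f x) :=
    mul_le_mul_of_nonneg_right (by exact_mod_cast hm) hr
  calc (1 - r * m / Fintype.card V) * f x + s / Fintype.card V
      = (Fintype.card V : ℝ)⁻¹ * (Fintype.card V * f x - m * (r * f x) + s) := by
        field_simp
    _ ≤ _ := mul_le_mul_of_nonneg_left (by linarith) (by positivity)

/-- A legal move of a particle of the configuration `x` from `v` to `w`. -/
structure IsMove {V : Type*} [Fintype V] (G : SimpleGraph V) (k : ℕ) (x y : V → Bool)
    (v w : V) : Prop where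
  mem : x ∈ OmegaK G k
  adj : G.Adj v w
  left : x v = true
  right : x w = false
  eq : y = Function.update (Function.update x w true) v false

theorem occupationProb_move {V : Type*} [Fintype V] [Nonempty V] {G : SimpleGraph V} {D K k : ℕ}
    (hD : ∀ v, (Finset.univ.filter (G.Adj v)).card ≤ D) (hk : k ≤ K) {c : ℝ} (hc : 0 < c)
    (hn₁ : 2 * c ≤ Fintype.card V) (hn₂ : 2 * (K * D * c) ≤ Fintype.card V)
    (hn₃ : 2 * (((K : ℝ) + 1) * D) ≤ Fintype.card V)
    {x y : V → Bool} {v w : V} (h : IsMove G k x y v w) (S : Set (V → Bool)) (a : ℝ) (T : ℕ) :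
    c * Real.exp (-(2 * (K * D * c))) * (1 / 2 * Real.exp (-(2 * ((K + 1) * D)))) *
        occupationProb (kcipKernel G (c / Fintype.card V)) S T a y ≤
      occupationProb (kcipKernel G (c / Fintype.card V)) S
        (T + Fintype.card V + Fintype.card V ^ 2) a x := by
  set n := Fintype.card V with hn
  have hn0 : 0 < n := Fintype.card_pos
  have hn1 : (1 : ℝ) ≤ n := by exact_mod_cast hn0
  have hnpos : (0 : ℝ) < n := by linarith
  set p := c / (n : ℝ) with hp
  have hp0 : 0 ≤ p := by positivity
  have hp2 : p ≤ 1 / 2 := by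
    rw [hp, div_le_iff₀ hnpos]; linarith
  have hK := kcipKernel_nonneg G hp0 (by linarith : p ≤ 1)
  have hK₁ := sum_kcipKernel G p
  set u := fun t z => occupationProb (kcipKernel G p) S t a z with hu
  have u0 : ∀ t z, 0 ≤ u t z := fun t z => occupationProb_nonneg hK _ _ _ _
  have umono : ∀ z, Monotone fun t => u t z := fun z => occupationProb_mono hK hK₁ S a z
  have ustep : ∀ t z, ∑ y, kcipKernel G p z y * u t y ≤ u (t + 1) z := fun t z =>
    sum_mul_occupationProb_le hK S t a z
  set z := Function.update x w true with hz
  have hvw : v ≠ w := h.adj.ne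
  have hzv : z v = true := by simp [hz, hvw, h.left]
  have hkK : (k : ℝ) ≤ K := by exact_mod_cast hk
  have step1 : ∀ t, 1 / 2 * Real.exp (-(2 * ((K + 1) * D))) * u t y ≤ u (t + n) z := by
    intro t
    have hl : ((K + 1) * D : ℝ) / n ≤ 1 / 2 := by
      rw [div_le_iff₀ hnpos]; linarith
    have := mul_le_of_jump (u := fun j => u (t + j) z) (A := u t y) (μ := 1 / 2 / n)
      (l := (K + 1) * D / n) (u0 t y) (by positivity) (by positivity) (by linarith) (u0 _ _) ?_ n
    · refine le_trans ?_ this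
      refine mul_le_mul_of_nonneg_right ?_ (u0 t y)
      have e := exp_le_one_sub_pow (by positivity) hl n
      have e1 : (n : ℝ) * ((K + 1) * D / n) = (K + 1) * D := by field_simp
      have e2 : (n : ℝ) * (1 / 2 / n) = 1 / 2 := by field_simp
      rw [e1] at e
      rw [e2]
      linarith
    · intro j
      refine le_trans ?_ (ustep (t + j) z)
      have hm : (updatable G z).card ≤ (K + 1) * D := by
        refine (card_updatable_le G hD z).trans (Nat.mul_le_mul_right D ?_)
        rw [hz, numParticles_update_true h.right, h.mem.1]
        omega
      have := le_sum_kcipKernel_mul G (p := p) z (u (t + j)) (r := 1) (s := 1 / 2 * u t y)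
        (by simpa using u0 _ _) (w := v) ?_ (mem_updatable_of_adj h.adj.symm (by simp [hz])) hm
      · refine le_trans (le_of_eq ?_) this
        push_cast
        ring
      · intro b _
        have h1 := mul_nonneg hp0 (u0 (t + j) (Function.update z b true))
        have h2 := mul_nonneg (by linarith : 0 ≤ 1 - p) (u0 (t + j) (Function.update z b false))
        split_ifs with hb
        · subst hb
          rw [← h.eq] at h2 ⊢
          have h3 : u t y ≤ u (t + j) y := umono y (Nat.le_add_right t j)
          have h4 : 1 / 2 * u t y ≤ (1 - p) * u (t + j) y :=
            mul_le_mul (by linarith) h3 (u0 _ _) (by linarith)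
          linarith
        · linarith
  have step2 : ∀ t, c * Real.exp (-(2 * (K * D * c))) * u t z ≤ u (t + n ^ 2) x := by
    intro t
    have hl : (K * D * c : ℝ) / n ^ 2 ≤ 1 / 2 := by
      rw [div_le_iff₀ (by positivity)]
      nlinarith
    have := mul_le_of_jump (u := fun j => u (t + j) x) (A := u t z) (μ := c / n ^ 2)
      (l := K * D * c / n ^ 2) (u0 t z) (by positivity) (by positivity) (by linarith) (u0 _ _) ?_
      (n ^ 2)
    · refine le_trans ?_ this
      refine mul_le_mul_of_nonneg_right ?_ (u0 t z)
      have e := exp_le_one_sub_pow (by positivity) hl (n ^ 2)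
      push_cast at e ⊢
      have e1 : (n : ℝ) ^ 2 * (K * D * c / n ^ 2) = K * D * c := by field_simp
      have e2 : (n : ℝ) ^ 2 * (c / n ^ 2) = c := by field_simp
      rw [e1] at e
      rw [e2]
      exact mul_le_mul_of_nonneg_left e hc.le
    · intro j
      refine le_trans ?_ (ustep (t + j) x)
      have hm : (updatable G x).card ≤ K * D := by
        refine (card_updatable_le G hD x).trans (Nat.mul_le_mul_right D ?_)
        rw [h.mem.1]
        exact hk
      have := le_sum_kcipKernel_mul G (p := p) x (u (t + j)) (r := p) (s := p * u t z)
        (mul_nonneg hp0 (u0 _ _)) (w := w) ?_ (mem_updatable_of_adj h.adj h.left) hm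
      · refine le_trans (le_of_eq ?_) this
        rw [← hn, hp]
        push_cast
        field_simp
      · intro b hb
        have hxb := eq_false_of_mem_updatable h.mem hb
        have e : Function.update x b false = x := by rw [← hxb, Function.update_eq_self]
        rw [e]
        have h1 := mul_nonneg hp0 (u0 (t + j) (Function.update x b true))
        split_ifs with hbw
        · subst hbw
          have h3 : u t z ≤ u (t + j) z := umono z (Nat.le_add_right t j)
          have h4 := mul_le_mul_of_nonneg_left h3 hp0
          rw [hz] at h4 ⊢
          linarith
        · linarith
  calc _ = c * Real.exp (-(2 * (K * D * c))) *
        (1 / 2 * Real.exp (-(2 * ((K + 1) * D))) * u T y) := by simp only [hu]; ring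
    _ ≤ c * Real.exp (-(2 * (K * D * c))) * u (T + n) z :=
        mul_le_mul_of_nonneg_left (step1 T) (by positivity)
    _ ≤ _ := step2 (T + n)

/-! ### A potential for the KCIP built from a pair interaction -/

/-- The total interaction of the particles of `x`, summed over ordered pairs. -/
def energy {V : Type*} [Fintype V] (g : V → V → ℝ) (x : V → Bool) : ℝ :=
  ∑ u, ∑ v, if x u = true ∧ x v = true ∧ u ≠ v then g u v else 0

theorem energy_nonneg {V : Type*} [Fintype V] {g : V → V → ℝ} (hg : ∀ u v, 0 ≤ g u v)
    (x : V → Bool) : 0 ≤ energy g x := by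
  refine Finset.sum_nonneg fun u _ => Finset.sum_nonneg fun v _ => ?_
  split_ifs
  exacts [hg u v, le_rfl]

theorem le_energy {V : Type*} [Fintype V] {g : V → V → ℝ} (hg : ∀ u v, 0 ≤ g u v)
    {x : V → Bool} {u v : V} (hu : x u = true) (hv : x v = true) (huv : u ≠ v) :
    g u v ≤ energy g x := by
  have h : ∀ a b, 0 ≤ if x a = true ∧ x b = true ∧ a ≠ b then g a b else 0 := by
    intro a b
    split_ifs
    exacts [hg a b, le_rfl]
  calc g u v = if x u = true ∧ x v = true ∧ u ≠ v then g u v else 0 := by simp [hu, hv, huv]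
    _ ≤ ∑ b, if x u = true ∧ x b = true ∧ u ≠ b then g u b else 0 :=
        Finset.single_le_sum (f := fun b => if x u = true ∧ x b = true ∧ u ≠ b then g u b else 0)
          (fun b _ => h u b) (Finset.mem_univ v)
    _ ≤ _ := Finset.single_le_sum
        (f := fun a => ∑ b, if x a = true ∧ x b = true ∧ a ≠ b then g a b else 0)
        (fun a _ => Finset.sum_nonneg fun b _ => h a b) (Finset.mem_univ u)

theorem energy_update_true {V : Type*} [Fintype V] {g : V → V → ℝ}
    (hg : ∀ u v, g u v = g v u) {x : V → Bool} {w : V} (hw : x w = false) :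
    energy g (Function.update x w true) = energy g x + 2 * ∑ u, if x u = true then g w u else 0 := by
  have e : ∀ a b, (if Function.update x w true a = true ∧ Function.update x w true b = true ∧ a ≠ b
        then g a b else 0) =
      (if x a = true ∧ x b = true ∧ a ≠ b then g a b else 0) +
        (if a = w then (if x b = true then g w b else 0) else 0) +
        (if b = w then (if x a = true then g w a else 0) else 0) := by
    intro a b
    by_cases ha : a = w
    · subst ha
      by_cases hb : b = a
      · subst hb; simp [hw]
      · simp [hb, hw, Ne.symm hb]
    · by_cases hb : b = w
      · subst hb; simp [ha, hw, hg a b]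
      · simp [ha, hb]
  unfold energy
  simp_rw [e, Finset.sum_add_distrib]
  have e2 : ∑ a : V, ∑ b : V, (if a = w then (if x b = true then g w b else 0) else 0) =
      ∑ u, if x u = true then g w u else 0 := by
    rw [Finset.sum_comm]
    simp
  have e3 : ∑ a : V, ∑ b : V, (if b = w then (if x a = true then g w a else 0) else 0) =
      ∑ u, if x u = true then g w u else 0 := by
    simp
  rw [e2, e3]
  ring

theorem energy_move_sub {V : Type*} [Fintype V] {g : V → V → ℝ}
    (hg : ∀ u v, g u v = g v u) {x : V → Bool} {v w : V} (hv : x v = true) (hw : x w = false) :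
    energy g (Function.update (Function.update x w true) v false) - energy g x =
      2 * ∑ u, if x u = true ∧ u ≠ v then g w u - g v u else 0 := by
  have hvw : v ≠ w := by rintro rfl; simp [hv] at hw
  set q := Function.update x v false with hq
  have h1 : x = Function.update q v true := by
    rw [hq, Function.update_idem, ← hv, Function.update_eq_self]
  have h2 : Function.update (Function.update x w true) v false = Function.update q w true := by
    rw [hq, Function.update_comm hvw.symm]
  have h3 : ∀ u, q u = true ↔ x u = true ∧ u ≠ v := by
    intro u
    by_cases hu : u = v
    · subst hu; simp [hq]
    · simp [hq, hu]
  have hqv : q v = false := by simp [hq]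
  have hqw : q w = false := by simp [hq, hvw.symm, hw]
  have e1 : energy g x = energy g q + 2 * ∑ u, if q u = true then g v u else 0 := by
    conv_lhs => rw [h1]
    exact energy_update_true hg hqv
  rw [h2, energy_update_true hg hqw, e1, add_sub_add_left_eq_sub, ← mul_sub,
    ← Finset.sum_sub_distrib]
  congr 1
  refine Finset.sum_congr rfl fun u _ => ?_
  simp only [h3]
  split_ifs <;> simp

/-- `y` is a configuration of `k + 1` particles, isolated except for the adjacent ones at
`v` and `w`. -/
structure IsPair {V : Type*} [Fintype V] (G : SimpleGraph V) (k : ℕ) (y : V → Bool) (v w : V) :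
    Prop where
  adj : G.Adj v w
  left : y v = true
  right : y w = true
  erase_left : Function.update y v false ∈ OmegaK G k
  erase_right : Function.update y w false ∈ OmegaK G k

theorem IsPair.notMem {V : Type*} [Fintype V] {G : SimpleGraph V} {k : ℕ} {y : V → Bool} {v w : V}
    (h : IsPair G k y v w) (j : ℕ) : y ∉ OmegaK G j :=
  fun hy => hy.2 v w h.adj ⟨h.left, h.right⟩

theorem IsPair.numParticles_eq {V : Type*} [Fintype V] {G : SimpleGraph V} {k : ℕ} {y : V → Bool}
    {v w : V} (h : IsPair G k y v w) : numParticles y = k + 1 := by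
  rw [← numParticles_update_false h.left, h.erase_left.1]

theorem IsPair.eq_or_eq {V : Type*} [Fintype V] {G : SimpleGraph V} {k : ℕ} {y : V → Bool}
    {v w b : V} (h : IsPair G k y v w) (hb : Function.update y b false ∈ OmegaK G k) :
    b = v ∨ b = w := by
  by_contra! hne
  refine hb.2 v w h.adj ⟨?_, ?_⟩
  · rw [Function.update_of_ne hne.1.symm, h.left]
  · rw [Function.update_of_ne hne.2.symm, h.right]

theorem IsPair.eq_false {V : Type*} [Fintype V] {G : SimpleGraph V} {k : ℕ} {y : V → Bool}
    {v w b : V} (h : IsPair G k y v w) (hbv : b ≠ v) (hbw : b ≠ w) (hb : b ∈ updatable G y) :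
    y b = false := by
  simp only [updatable, Finset.mem_filter, Finset.mem_univ, true_and] at hb
  obtain ⟨a, hab, ha⟩ := hb
  refine Bool.eq_false_iff.2 fun hyb => ?_
  by_cases hav : a = v
  · subst hav
    refine h.erase_right.2 a b hab ⟨?_, ?_⟩
    · rw [Function.update_of_ne h.adj.ne, ha]
    · rw [Function.update_of_ne hbw, hyb]
  · refine h.erase_left.2 a b hab ⟨?_, ?_⟩
    · rw [Function.update_of_ne hav, ha]
    · rw [Function.update_of_ne hbv, hyb]

/-- The normalized energy on `Ω_k`; on configurations with an adjacent pair, `e` plus the mean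
of the values at the two configurations obtained by erasing one particle of the pair; and `1`
elsewhere. -/
def potential {V : Type*} [Fintype V] (G : SimpleGraph V) (g : V → V → ℝ) (k : ℕ) (B e : ℝ)
    (y : V → Bool) : ℝ :=
  if y ∈ OmegaK G k then energy g y / B
  else if ∃ v w, IsPair G k y v w then
    e + (∑ b, if Function.update y b false ∈ OmegaK G k then
      energy g (Function.update y b false) else 0) / (2 * B)
  else 1

theorem potential_of_mem {V : Type*} [Fintype V] {G : SimpleGraph V} {g : V → V → ℝ} {k : ℕ}
    {B e : ℝ} {y : V → Bool} (hy : y ∈ OmegaK G k) : potential G g k B e y = energy g y / B :=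
  if_pos hy

theorem potential_of_isPair {V : Type*} [Fintype V] {G : SimpleGraph V} {g : V → V → ℝ} {k : ℕ}
    {B e : ℝ} {y : V → Bool} {v w : V} (h : IsPair G k y v w) :
    potential G g k B e y = e + (energy g (Function.update y v false) +
      energy g (Function.update y w false)) / (2 * B) := by
  unfold potential
  rw [if_neg (h.notMem k), if_pos ⟨v, w, h⟩, Fintype.sum_eq_add v w h.adj.ne,
    if_pos h.erase_left, if_pos h.erase_right]
  rintro b ⟨hbv, hbw⟩
  rw [if_neg]
  intro hb
  rcases h.eq_or_eq hb with h | h <;> contradiction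

theorem potential_eq_one {V : Type*} [Fintype V] {G : SimpleGraph V} {g : V → V → ℝ} {k : ℕ}
    {B e : ℝ} {y : V → Bool} (hy : k + 1 < numParticles y) : potential G g k B e y = 1 := by
  unfold potential
  rw [if_neg, if_neg]
  · rintro ⟨v, w, h⟩
    rw [h.numParticles_eq] at hy
    omega
  · intro h
    rw [h.1] at hy
    omega

theorem potential_nonneg {V : Type*} [Fintype V] {G : SimpleGraph V} {g : V → V → ℝ} {k : ℕ}
    {B e : ℝ} (hg : ∀ u v, 0 ≤ g u v) (hB : 0 < B) (he : 0 ≤ e) (y : V → Bool) :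
    0 ≤ potential G g k B e y := by
  by_cases hy : y ∈ OmegaK G k
  · rw [potential_of_mem hy]
    exact div_nonneg (energy_nonneg hg y) hB.le
  · by_cases hp : ∃ v w, IsPair G k y v w
    · obtain ⟨v, w, h⟩ := hp
      rw [potential_of_isPair h]
      have := energy_nonneg hg (Function.update y v false)
      have := energy_nonneg hg (Function.update y w false)
      positivity
    · rw [potential, if_neg hy, if_neg hp]
      exact zero_le_one

theorem le_potential_of_notMem {V : Type*} [Fintype V] {G : SimpleGraph V} {g : V → V → ℝ} {k : ℕ}
    {B e : ℝ} (hg : ∀ u v, 0 ≤ g u v) (hB : 0 < B) {y : V → Bool} (hy : y ∉ OmegaK G k) :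
    min e 1 ≤ potential G g k B e y := by
  by_cases hp : ∃ v w, IsPair G k y v w
  · obtain ⟨v, w, h⟩ := hp
    rw [potential_of_isPair h]
    have := energy_nonneg hg (Function.update y v false)
    have := energy_nonneg hg (Function.update y w false)
    exact (min_le_left _ _).trans (le_add_of_nonneg_right (by positivity))
  · rw [potential, if_neg hy, if_neg hp]
    exact min_le_right _ _

/-- A pair interaction on `G` which is nearly superharmonic off the diagonal, and at least `B`
for vertices at distance at most two. -/
structure IsInteraction {V : Type*} [Fintype V] (G : SimpleGraph V) (g : V → V → ℝ) (B l : ℝ) :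
    Prop where
  nonneg : ∀ u v, 0 ≤ g u v
  symm : ∀ u v, g u v = g v u
  pos : 0 < B
  le_of_adj : ∀ u v, G.Adj u v → B ≤ g u v
  le_of_adj_adj : ∀ u v w, u ≠ v → G.Adj u w → G.Adj w v → B ≤ g u v
  nonneg_defect : 0 ≤ l
  laplacian_le : ∀ u v, u ≠ v → ∑ w, (if G.Adj v w then g w u - g v u else 0) ≤ l

theorem isPair_of_energy_lt {V : Type*} [Fintype V] {G : SimpleGraph V} {g : V → V → ℝ} {B l : ℝ}
    (hg : IsInteraction G g B l) {k : ℕ} {x : V → Bool} (hx : x ∈ OmegaK G k)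
    (hE : energy g x < B) {v b : V} (hv : x v = true) (hvb : G.Adj v b) :
    (∀ u, x u = true → G.Adj u b → u = v) ∧ IsPair G k (Function.update x b true) v b := by
  have hb : x b = false := Bool.eq_false_iff.2 fun h => hx.2 v b hvb ⟨hv, h⟩
  have huniq : ∀ u, x u = true → G.Adj u b → u = v := by
    intro u hu hub
    by_contra huv
    exact absurd (hg.le_of_adj_adj u v b huv hub hvb.symm)
      (not_le.2 ((le_energy hg.nonneg hu hv huv).trans_lt hE))
  have hvz : Function.update x b true v = true := by simp [hvb.ne, hv]
  refine ⟨huniq, hvb, hvz, by simp, ⟨?_, ?_⟩, ?_⟩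
  · have := numParticles_update_false hvz
    rw [numParticles_update_true hb, hx.1] at this
    omega
  · rintro a a' haa' ⟨ha, ha'⟩
    have hav : a ≠ v := by rintro rfl; simp at ha
    have hav' : a' ≠ v := by rintro rfl; simp at ha'
    rw [Function.update_of_ne hav] at ha
    rw [Function.update_of_ne hav'] at ha'
    by_cases hab : a = b
    · subst hab
      have : a' ≠ a := haa'.ne.symm
      rw [Function.update_of_ne this] at ha'
      exact hav' (huniq a' ha' haa'.symm)
    · rw [Function.update_of_ne hab] at ha
      by_cases hab' : a' = b
      · subst hab'
        exact hav (huniq a ha haa')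
      · rw [Function.update_of_ne hab'] at ha'
        exact hx.2 a a' haa' ⟨ha, ha'⟩
  · rw [Function.update_idem, ← hb, Function.update_eq_self]
    exact hx

theorem sum_kcipKernel_mul_potential_le_of_mem {V : Type*} [Fintype V] [Nonempty V]
    {G : SimpleGraph V} {g : V → V → ℝ} {B l : ℝ} (hg : IsInteraction G g B l) {D K k : ℕ}
    (hD : ∀ v, (Finset.univ.filter (G.Adj v)).card ≤ D) (hk : k ≤ K) {p e : ℝ} (hp : 0 ≤ p)
    (he : 0 ≤ e) {x : V → Bool} (hx : x ∈ OmegaK G k) (hE : energy g x < B) :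
    ∑ y, kcipKernel G p x y * potential G g k B e y ≤
      potential G g k B e x + p / Fintype.card V * (K * (D * e + K * l / B)) := by
  have hB := hg.pos
  have hl := hg.nonneg_defect
  set Φ := potential G g k B e with hΦ
  have hn : (0 : ℝ) < Fintype.card V := by exact_mod_cast Fintype.card_pos
  have hjump : ∀ b, (if b ∈ updatable G x then Φ (Function.update x b true) - Φ x else 0) =
      ∑ v, if x v = true then (if G.Adj v b then
        e + (∑ u, if x u = true ∧ u ≠ v then g b u - g v u else 0) / B else 0) else 0 := by
    intro b
    by_cases hb : b ∈ updatable G x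
    · have hxb := eq_false_of_mem_updatable hx hb
      rw [if_pos hb]
      simp only [updatable, Finset.mem_filter, Finset.mem_univ, true_and] at hb
      obtain ⟨v, hvb, hv⟩ := hb
      obtain ⟨huniq, hpair⟩ := isPair_of_energy_lt hg hx hE hv hvb
      rw [Fintype.sum_eq_single v, if_pos hv, if_pos hvb, hΦ, potential_of_isPair hpair,
        potential_of_mem hx]
      · have h1 := energy_move_sub hg.symm hv hxb
        have h2 : Function.update (Function.update x b true) b false = x := by
          rw [Function.update_idem, ← hxb, Function.update_eq_self]
        rw [h2]
        rw [sub_eq_iff_eq_add] at h1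
        rw [h1]
        field_simp
        ring
      · intro u huv
        split_ifs with h1 h2
        · exact absurd (huniq u h1 h2) huv
        · rfl
        · rfl
    · rw [if_neg hb]
      refine (Finset.sum_eq_zero fun v _ => ?_).symm
      split_ifs with h1 h2
      · exact absurd (mem_updatable_of_adj h2 h1) hb
      · rfl
      · rfl
  have hsum : ∑ b, (if b ∈ updatable G x then Φ (Function.update x b true) - Φ x else 0) ≤
      K * (D * e + K * l / B) := by
    simp_rw [hjump]
    rw [Finset.sum_comm]
    have hcard : ((Finset.univ.filter fun v => x v = true).card : ℝ) ≤ K := by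
      exact_mod_cast hx.1.trans_le hk
    have hbound : ∀ v, ∑ b, (if G.Adj v b then
        e + (∑ u, if x u = true ∧ u ≠ v then g b u - g v u else 0) / B else 0) ≤
          D * e + K * l / B := by
      intro v
      have e1 : ∀ b, (if G.Adj v b then
          e + (∑ u, if x u = true ∧ u ≠ v then g b u - g v u else 0) / B else 0) =
          (if G.Adj v b then e else 0) + (∑ u, if x u = true then (if u ≠ v then
            (if G.Adj v b then g b u - g v u else 0) else 0) else 0) / B := by
        intro b
        by_cases hvb : G.Adj v b
        · simp only [hvb, if_true, ite_and]
        · simp [hvb]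
      simp_rw [e1]
      rw [Finset.sum_add_distrib, ← Finset.sum_filter, Finset.sum_const, nsmul_eq_mul,
        ← Finset.sum_div, Finset.sum_comm]
      refine add_le_add (mul_le_mul_of_nonneg_right (by exact_mod_cast hD v) he)
        (div_le_div_of_nonneg_right ?_ hB.le)
      calc _ ≤ ∑ u, if x u = true then l else 0 := by
            refine Finset.sum_le_sum fun u _ => ?_
            by_cases hu : x u = true
            · by_cases huv : u = v
              · simp [huv]
                split_ifs <;> simp [hl]
              · simp only [hu, if_true, ne_eq, huv, not_false_eq_true]
                exact hg.laplacian_le u v huv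
            · simp [hu]
        _ ≤ K * l := by
            rw [← Finset.sum_filter, Finset.sum_const, nsmul_eq_mul]
            exact mul_le_mul_of_nonneg_right hcard hl
    calc _ ≤ ∑ v, if x v = true then (D * e + K * l / B) else 0 := by
          refine Finset.sum_le_sum fun v _ => ?_
          by_cases hv : x v = true
          · simpa only [hv, if_true] using hbound v
          · simp [hv]
      _ ≤ _ := by
          rw [← Finset.sum_filter, Finset.sum_const, nsmul_eq_mul]
          exact mul_le_mul_of_nonneg_right hcard (by positivity)
  rw [sum_kcipKernel_mul]
  have e2 : ∀ v, (if v ∈ updatable G x then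
      p * Φ (Function.update x v true) + (1 - p) * Φ (Function.update x v false) else Φ x) =
      Φ x + p * (if v ∈ updatable G x then Φ (Function.update x v true) - Φ x else 0) := by
    intro v
    by_cases hv : v ∈ updatable G x
    · have hxv := eq_false_of_mem_updatable hx hv
      have : Function.update x v false = x := by rw [← hxv, Function.update_eq_self]
      simp only [hv, if_true, this]
      ring
    · simp [hv]
  simp_rw [e2]
  rw [Finset.sum_add_distrib, ← Finset.mul_sum, Finset.sum_const, Finset.card_univ, nsmul_eq_mul,
    mul_add, inv_mul_cancel_left₀ hn.ne', ← mul_assoc, div_eq_inv_mul]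
  gcongr

theorem sum_kcipKernel_mul_potential_le_of_isPair {V : Type*} [Fintype V] [Nonempty V]
    {G : SimpleGraph V} {g : V → V → ℝ} {B : ℝ} {D K k : ℕ}
    (hD : ∀ v, (Finset.univ.filter (G.Adj v)).card ≤ D) (hk : k ≤ K) {p e : ℝ} (hp : 0 ≤ p)
    (hp₂ : p ≤ 1 / 2) (he : 0 ≤ e) (hg : ∀ u v, 0 ≤ g u v) (hB : 0 < B) {y : V → Bool} {v w : V}
    (h : IsPair G k y v w) :
    ∑ z, kcipKernel G p y z * potential G g k B e z ≤
      potential G g k B e y + (p * ((K + 1) * D) - e) / Fintype.card V := by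
  have hn : (0 : ℝ) < Fintype.card V := by exact_mod_cast Fintype.card_pos
  set Φ := potential G g k B e with hΦ
  have hΦ0 : 0 ≤ Φ y := potential_nonneg hg hB he y
  have hmean : Φ (Function.update y v false) + Φ (Function.update y w false) = 2 * Φ y - 2 * e := by
    rw [hΦ, potential_of_isPair h, potential_of_mem h.erase_left, potential_of_mem h.erase_right]
    field_simp
    ring
  have hterm : ∀ b, (if b ∈ updatable G y then
      p * Φ (Function.update y b true) + (1 - p) * Φ (Function.update y b false) else Φ y) ≤
      Φ y + (if b ∈ updatable G y then p else 0) +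
        (if b = v then (1 - p) * (Φ (Function.update y v false) - Φ y) else 0) +
        (if b = w then (1 - p) * (Φ (Function.update y w false) - Φ y) else 0) := by
    intro b
    by_cases hbv : b = v
    · subst hbv
      have : Function.update y b true = y := by rw [← h.left, Function.update_eq_self]
      simp only [mem_updatable_of_adj h.adj.symm h.right, if_true, h.adj.ne, if_false, this]
      linarith
    · by_cases hbw : b = w
      · subst hbw
        have : Function.update y b true = y := by rw [← h.right, Function.update_eq_self]
        simp only [mem_updatable_of_adj h.adj h.left, if_true, hbv, if_false, this]
        linarith
      · by_cases hb : b ∈ updatable G y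
        · have hyb := h.eq_false hbv hbw hb
          have h1 : Function.update y b false = y := by rw [← hyb, Function.update_eq_self]
          have h2 : Φ (Function.update y b true) = 1 := by
            refine potential_eq_one ?_
            rw [numParticles_update_true hyb, h.numParticles_eq]
            omega
          simp only [hb, if_true, hbv, hbw, if_false, h1, h2]
          nlinarith
        · simp [hb, hbv, hbw]
  have hsum := Finset.sum_le_sum fun b (_ : b ∈ Finset.univ) => hterm b
  rw [Finset.sum_add_distrib, Finset.sum_add_distrib, Finset.sum_add_distrib,
    Finset.sum_ite_eq' Finset.univ v, Finset.sum_ite_eq' Finset.univ w,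
    if_pos (Finset.mem_univ v), if_pos (Finset.mem_univ w), ← Finset.sum_filter (· ∈ updatable G y),
    Finset.filter_mem_eq_inter, Finset.univ_inter, Finset.sum_const, Finset.sum_const,
    Finset.card_univ, nsmul_eq_mul, nsmul_eq_mul] at hsum
  have hcard : ((updatable G y).card : ℝ) ≤ (K + 1) * D := by
    have : (updatable G y).card ≤ (K + 1) * D := by
      refine (card_updatable_le G hD y).trans (Nat.mul_le_mul_right D ?_)
      rw [h.numParticles_eq]
      omega
    exact_mod_cast this
  rw [sum_kcipKernel_mul]
  calc _ ≤ (Fintype.card V : ℝ)⁻¹ * (Fintype.card V * Φ y + (p * ((K + 1) * D) - e)) := by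
        refine mul_le_mul_of_nonneg_left (hsum.trans ?_) (by positivity)
        nlinarith [mul_le_mul_of_nonneg_right hcard hp]
    _ = _ := by
        field_simp

/-- In the KCIP with density `c / n`, a configuration of `Ω_k` whose energy is small spends, with
probability bounded below, a positive fraction of the next `ε n³` steps in `Ω_k`. -/
theorem le_occupationProb_of_energy {V : Type*} [Fintype V] [Nonempty V] {G : SimpleGraph V}
    {g : V → V → ℝ} {B l : ℝ} (hg : IsInteraction G g B (l / Fintype.card V)) {D K k : ℕ}
    (hD : ∀ v, (Finset.univ.filter (G.Adj v)).card ≤ D) (hk : k ≤ K) {c : ℝ} (hc : 0 < c)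
    (hn : 2 * c ≤ Fintype.card V) {b : ℝ} (hb : (Fintype.card V : ℝ) ^ 2 ≤ b)
    {x : V → Bool} (hx : x ∈ OmegaK G k) (T : ℕ) :
    (1 : ℝ) - energy g x / B -
        c * (K * (D * (c * ((K + 1) * D) + 1) + K * l / B)) / (Fintype.card V : ℝ) ^ 3 * T ≤
      occupationProb (kcipKernel G (c / Fintype.card V)) (OmegaK G k) T (T + 1 - b) x := by
  set n := Fintype.card V with hn'
  have hn1 : (1 : ℝ) ≤ n := by exact_mod_cast (Fintype.card_pos : 0 < Fintype.card V)
  have hnpos : (0 : ℝ) < n := by linarith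
  have hb1 : 1 ≤ b := by nlinarith
  have hB := hg.pos
  have hl : 0 ≤ l := by
    have := mul_nonneg hg.nonneg_defect hnpos.le
    rwa [div_mul_cancel₀ _ hnpos.ne'] at this
  set p := c / (n : ℝ) with hp
  have hp0 : 0 ≤ p := by positivity
  have hp2 : p ≤ 1 / 2 := by
    rw [hp, div_le_iff₀ hnpos]; linarith
  set A := c * ((K + 1) * D) + 1 with hA
  have hA1 : 1 ≤ A := le_add_of_nonneg_left (by positivity)
  set e := A / (n : ℝ) with he
  have he0 : 0 ≤ e := by positivity
  have hbinv : 1 / b ≤ 1 / (n : ℝ) ^ 2 := one_div_le_one_div_of_le (by positivity) hb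
  have hn2 : 1 / (n : ℝ) ^ 2 ≤ 1 / n := one_div_le_one_div_of_le hnpos (by nlinarith)
  have hn3 : 1 / (n : ℝ) ≤ e := by rw [he]; gcongr
  have hn4 : 1 / (n : ℝ) ≤ 1 := by rw [div_le_one hnpos]; exact hn1
  have key := le_occupationProb_of_potential (kcipKernel_nonneg G hp0 (by linarith : p ≤ 1))
    (sum_kcipKernel G p) (S := OmegaK G k) (Φ := potential G g k B e) (b := b)
    (C := c * (K * (D * A + K * l / B)) / (n : ℝ) ^ 3)
    (by linarith) (by positivity) (potential_nonneg hg.nonneg hB he0)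
    (fun y hy => le_trans (le_min (by linarith) (by linarith))
      (le_potential_of_notMem (e := e) hg.nonneg hB hy)) ?_ T (T + 1 - b) (by linarith) x
  · rw [potential_of_mem hx, sub_sub_cancel, div_self (by linarith)] at key
    exact key
  · intro y hy
    by_cases hyk : y ∈ OmegaK G k
    · rw [if_pos hyk, add_zero]
      rw [potential_of_mem hyk, div_lt_one hB] at hy
      refine (sum_kcipKernel_mul_potential_le_of_mem hg hD hk hp0 he0 hyk hy).trans ?_
      rw [add_le_add_iff_left]
      refine le_of_eq ?_
      rw [hp, he, ← hn']
      field_simp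
    · rw [if_neg hyk]
      by_cases hpair : ∃ v w, IsPair G k y v w
      · obtain ⟨v, w, h⟩ := hpair
        have := sum_kcipKernel_mul_potential_le_of_isPair hD hk hp0 hp2 he0 hg.nonneg hB h
        have e1 : (p * ((K + 1) * D) - e) / (n : ℝ) = - (1 / (n : ℝ) ^ 2) := by
          rw [hp, he, hA]
          field_simp
          ring
        rw [← hn', e1] at this
        have : 0 ≤ c * (K * (D * A + K * l / B)) / (n : ℝ) ^ 3 := by positivity
        linarith
      · rw [potential, if_neg hyk, if_neg hpair] at hy
        exact absurd hy (lt_irrefl 1)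

/-! ### The lazy random walk on the torus -/

theorem torusGraph_adj_iff {L d : ℕ} (hL : 2 ≤ L) {u v : Fin d → ZMod L} :
    (torusGraph L d).Adj u v ↔ ∃ i, v = u + Pi.single i 1 ∨ v = u - Pi.single i 1 := by
  have : Fact (1 < L) := ⟨hL⟩
  have hs : ∀ i : Fin d, (fun j => if j = i then (1 : ZMod L) else 0) = Pi.single i 1 := by
    intro i
    funext j
    rw [Pi.single_apply]
  have h0 : ∀ i : Fin d, (Pi.single i 1 : Fin d → ZMod L) ≠ 0 := fun i => by simp
  simp only [torusGraph, SimpleGraph.fromRel_adj, hs]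
  constructor
  · rintro ⟨-, ⟨i, h⟩ | ⟨i, h⟩⟩
    · exact ⟨i, Or.inl h⟩
    · exact ⟨i, Or.inr (by rw [h, add_sub_cancel_right])⟩
  · rintro ⟨i, rfl | rfl⟩
    · exact ⟨fun h => h0 i (left_eq_add.1 h), Or.inl ⟨i, rfl⟩⟩
    · exact ⟨fun h => h0 i (sub_eq_self.1 h.symm), Or.inr ⟨i, by rw [sub_add_cancel]⟩⟩

theorem sum_torusGraph_adj {L d : ℕ} [NeZero L] (hL : 3 ≤ L) {M : Type*} [AddCommMonoid M]
    (v : Fin d → ZMod L) (f : (Fin d → ZMod L) → M) :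
    ∑ w, (if (torusGraph L d).Adj v w then f w else 0) =
      ∑ i, (f (v + Pi.single i 1) + f (v - Pi.single i 1)) := by
  have : Fact (1 < L) := ⟨by omega⟩
  have h2 : (1 : ZMod L) ≠ -1 := by
    intro h
    have h3 : ((2 : ℕ) : ZMod L) = 0 := by
      push_cast
      linear_combination h
    rw [ZMod.natCast_eq_zero_iff] at h3
    have := Nat.le_of_dvd (by norm_num) h3
    omega
  set F : Fin d × Bool → Fin d → ZMod L :=
    fun q => v + Pi.single q.1 (if q.2 then 1 else -1) with hF
  have hinj : Function.Injective F := by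
    rintro ⟨i, b⟩ ⟨j, b'⟩ h
    have h' : (Pi.single i (if b then 1 else -1) : Fin d → ZMod L) =
      Pi.single j (if b' then 1 else -1) := add_left_cancel h
    have hi := congrFun h' i
    rw [Pi.single_eq_same, Pi.single_apply] at hi
    by_cases hij : i = j
    · subst hij
      simp only [if_true] at hi
      cases b <;> cases b' <;>
        first
        | rfl
        | exact absurd (by simpa using hi) h2
        | exact absurd (by simpa using hi.symm) h2
    · cases b <;> simp [hij] at hi
  rw [← Finset.sum_filter]
  have himg : (Finset.univ.filter ((torusGraph L d).Adj v)) = Finset.univ.image F := by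
    ext w
    simp only [Finset.mem_filter, Finset.mem_univ, true_and, Finset.mem_image, Prod.exists,
      torusGraph_adj_iff (by omega : 2 ≤ L), Bool.exists_bool, hF]
    refine exists_congr fun i => ?_
    simp [Pi.single_neg, sub_eq_add_neg, eq_comm, or_comm]
  rw [himg, Finset.sum_image fun a _ b _ h => hinj h, Fintype.sum_prod_type]
  refine Finset.sum_congr rfl fun i _ => ?_
  simp [hF, Pi.single_neg, sub_eq_add_neg]

theorem card_torusGraph_adj {L d : ℕ} [NeZero L] (hL : 3 ≤ L) (v : Fin d → ZMod L) :
    (Finset.univ.filter ((torusGraph L d).Adj v)).card = 2 * d := by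
  rw [Finset.card_filter, sum_torusGraph_adj hL v fun _ => 1]
  simp [mul_comm]

/-- The heat kernel of the lazy simple random walk on the torus. -/
def heatKernel (L d : ℕ) : ℕ → (Fin d → ZMod L) → ℝ
  | 0 => fun z => if z = 0 then 1 else 0
  | t + 1 => fun z => heatKernel L d t z / 2 +
      (∑ i, (heatKernel L d t (z + Pi.single i 1) + heatKernel L d t (z - Pi.single i 1))) /
        (4 * d)

theorem heatKernel_nonneg (L d t : ℕ) (z : Fin d → ZMod L) : 0 ≤ heatKernel L d t z := by
  induction t generalizing z with
  | zero =>
    simp only [heatKernel]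
    split_ifs <;> norm_num
  | succ t ih =>
    simp only [heatKernel]
    have := Finset.sum_nonneg fun i (_ : i ∈ (Finset.univ : Finset (Fin d))) =>
      add_nonneg (ih (z + Pi.single i 1)) (ih (z - Pi.single i 1))
    have := ih z
    positivity

theorem heatKernel_neg (L d t : ℕ) (z : Fin d → ZMod L) :
    heatKernel L d t (-z) = heatKernel L d t z := by
  induction t generalizing z with
  | zero => simp [heatKernel]
  | succ t ih =>
    simp only [heatKernel]
    rw [ih]
    congr 2
    refine Finset.sum_congr rfl fun i _ => ?_
    rw [← ih (z + Pi.single i 1), ← ih (z - Pi.single i 1), add_comm]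
    congr 2 <;> abel

theorem heatKernel_le_succ {L d : ℕ} (hL : 2 ≤ L) (t : ℕ) {z w : Fin d → ZMod L}
    (h : (torusGraph L d).Adj z w) :
    heatKernel L d t w / (4 * d) ≤ heatKernel L d (t + 1) z := by
  obtain ⟨i, hi⟩ := (torusGraph_adj_iff hL).1 h
  have h0 := heatKernel_nonneg L d t
  simp only [heatKernel]
  have h1 := Finset.single_le_sum
    (f := fun i => heatKernel L d t (z + Pi.single i 1) + heatKernel L d t (z - Pi.single i 1))
    (fun i _ => add_nonneg (h0 _) (h0 _)) (Finset.mem_univ i)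
  have h2 : heatKernel L d t w ≤
      heatKernel L d t (z + Pi.single i 1) + heatKernel L d t (z - Pi.single i 1) := by
    rcases hi with rfl | rfl
    · exact le_add_of_nonneg_right (h0 _)
    · exact le_add_of_nonneg_left (h0 _)
  have h3 := h0 z
  have h4 : heatKernel L d t w / (4 * d) ≤ (∑ i, (heatKernel L d t (z + Pi.single i 1) +
      heatKernel L d t (z - Pi.single i 1))) / (4 * d) :=
    div_le_div_of_nonneg_right (h2.trans h1) (by positivity)
  linarith

theorem heatKernel_eq_zero {L d : ℕ} (t : ℕ) (j : Fin d) (z : Fin d → ZMod L)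
    (hz : ∀ m : ℤ, |m| ≤ t → z j ≠ m) : heatKernel L d t z = 0 := by
  induction t generalizing z with
  | zero =>
    have := hz 0 (by simp)
    simp only [heatKernel]
    rw [if_neg]
    rintro rfl
    simp at this
  | succ t ih =>
    have hshift : ∀ s : ℤ, |s| ≤ 1 → ∀ z' : Fin d → ZMod L, z' j = z j + s →
        heatKernel L d t z' = 0 := by
      intro s hs z' hz'
      refine ih z' fun m hm h => hz (m - s) ?_ ?_
      · have := abs_sub m s
        push_cast
        omega
      · push_cast
        rw [← h, hz']
        ring
    simp only [heatKernel]
    rw [hshift 0 (by simp) z (by simp), Finset.sum_eq_zero]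
    · simp
    · intro i _
      by_cases hij : j = i
      · subst hij
        rw [hshift 1 (by simp) _ (by simp), hshift (-1) (by simp) _ (by simp [sub_eq_add_neg]),
          add_zero]
      · rw [hshift 0 (by simp) _ (by simp [hij]),
          hshift 0 (by simp) _ (by simp [hij]), add_zero]

/-- The Fourier multiplier of the lazy simple random walk on the torus. -/
def walkMultiplier {L d : ℕ} [NeZero L] (ξ : Fin d → ZMod L) : ℝ :=
  1 / 2 + (∑ i, (ZMod.stdAddChar (ξ i) : ℂ).re) / (2 * d)

theorem stdAddChar_norm {L : ℕ} [NeZero L] (a : ZMod L) : ‖(ZMod.stdAddChar a : ℂ)‖ = 1 :=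
  AddChar.norm_apply _ _

theorem heatKernel_eq_sum {L d : ℕ} [NeZero L] (t : ℕ) (z : Fin d → ZMod L) :
    (heatKernel L d t z : ℂ) = ((L : ℂ) ^ d)⁻¹ *
      ∑ ξ : Fin d → ZMod L, (walkMultiplier ξ : ℂ) ^ t * ∏ i, ZMod.stdAddChar (ξ i * z i) := by
  have hL0 : (L : ℂ) ≠ 0 := by exact_mod_cast NeZero.ne L
  induction t generalizing z with
  | zero =>
    have h1 : ∀ b : ZMod L, ∑ a : ZMod L, (ZMod.stdAddChar (a * b) : ℂ) =
        if b = 0 then (L : ℂ) else 0 := by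
      intro b
      have := AddChar.sum_mulShift (R := ZMod L) (R' := ℂ) b
        (ZMod.isPrimitive_stdAddChar L)
      rw [this, ZMod.card]
      push_cast
      rfl
    have h2 := (Finset.prod_univ_sum (fun _ : Fin d => (Finset.univ : Finset (ZMod L)))
      (fun i a => (ZMod.stdAddChar (a * z i) : ℂ))).symm
    rw [Fintype.piFinset_univ] at h2
    simp only [pow_zero, one_mul]
    rw [h2]
    simp_rw [h1]
    simp only [heatKernel]
    by_cases hz : z = 0
    · subst hz
      simp [hL0]
    · obtain ⟨i, hi⟩ := Function.ne_iff.1 hz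
      rw [if_neg hz, Finset.prod_eq_zero (Finset.mem_univ i) (if_neg hi)]
      simp
  | succ t ih =>
    have hshift : ∀ (ξ : Fin d → ZMod L) (j : Fin d) (s : ZMod L),
        ∏ i, (ZMod.stdAddChar (ξ i * (z + Pi.single j s : Fin d → ZMod L) i) : ℂ) =
          ZMod.stdAddChar (ξ j * s) * ∏ i, ZMod.stdAddChar (ξ i * z i) := by
      intro ξ j s
      simp_rw [Pi.add_apply, mul_add, AddChar.map_add_eq_mul]
      rw [Finset.prod_mul_distrib, mul_comm]
      congr 1
      rw [Fintype.prod_eq_single j]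
      · simp
      · intro i hi
        simp [hi]
    have hre : ∀ a : ZMod L, (ZMod.stdAddChar a : ℂ) + ZMod.stdAddChar (-a) =
        2 * ((ZMod.stdAddChar a : ℂ).re : ℂ) := by
      intro a
      rw [AddChar.map_neg_eq_conj, Complex.add_conj]
      push_cast
      rfl
    simp only [heatKernel]
    push_cast
    have hsub : ∀ i : Fin d, z - Pi.single i 1 = z + Pi.single i (-1) := fun i => by
      rw [Pi.single_neg, sub_eq_add_neg]
    simp_rw [hsub, ih, hshift]
    simp_rw [← mul_add, ← Finset.mul_sum]
    rw [mul_div_assoc, mul_div_assoc, ← mul_add]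
    congr 1
    simp_rw [← Finset.sum_add_distrib]
    rw [Finset.sum_comm, Finset.sum_div, Finset.sum_div, ← Finset.sum_add_distrib]
    refine Finset.sum_congr rfl fun ξ _ => ?_
    have : ∀ i, (walkMultiplier ξ : ℂ) ^ t * (ZMod.stdAddChar (ξ i * 1) *
          ∏ i, ZMod.stdAddChar (ξ i * z i)) + (walkMultiplier ξ : ℂ) ^ t *
          (ZMod.stdAddChar (ξ i * (-1)) * ∏ i, ZMod.stdAddChar (ξ i * z i)) =
        (2 * ((ZMod.stdAddChar (ξ i) : ℂ).re : ℂ)) *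
          ((walkMultiplier ξ : ℂ) ^ t * ∏ i, ZMod.stdAddChar (ξ i * z i)) := by
      intro i
      rw [← hre (ξ i), mul_one, mul_neg_one]
      ring
    simp_rw [this]
    have hw : (walkMultiplier ξ : ℂ) =
        1 / 2 + (∑ i, ((ZMod.stdAddChar (ξ i) : ℂ).re : ℂ)) / (2 * d) := by
      rw [walkMultiplier]
      push_cast
      rfl
    rw [← Finset.sum_mul, ← Finset.mul_sum, pow_succ', mul_assoc (walkMultiplier ξ : ℂ)]
    generalize (walkMultiplier ξ : ℂ) ^ t * ∏ i, ZMod.stdAddChar (ξ i * z i) = Q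
    rw [hw]
    ring

theorem abs_stdAddChar_re_le {L : ℕ} [NeZero L] (a : ZMod L) :
    |(ZMod.stdAddChar a : ℂ).re| ≤ 1 :=
  (Complex.abs_re_le_norm _).trans (stdAddChar_norm a).le

theorem walkMultiplier_nonneg {L d : ℕ} [NeZero L] (ξ : Fin d → ZMod L) :
    0 ≤ walkMultiplier ξ := by
  unfold walkMultiplier
  have h := Finset.sum_le_sum fun i (_ : i ∈ (Finset.univ : Finset (Fin d))) =>
    (abs_le.1 (abs_stdAddChar_re_le (ξ i))).1
  rw [Finset.sum_const, Finset.card_univ, Fintype.card_fin, nsmul_eq_mul] at h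
  rcases Nat.eq_zero_or_pos d with rfl | hd
  · simp
  · have hd' : (0 : ℝ) < d := by exact_mod_cast hd
    have : -(1 / 2) ≤ (∑ i, (ZMod.stdAddChar (ξ i) : ℂ).re) / (2 * d) := by
      rw [le_div_iff₀ (by positivity)]
      linarith
    linarith

theorem walkMultiplier_pow_le {L d : ℕ} [NeZero L] (hd : 0 < d) (t : ℕ) (ξ : Fin d → ZMod L) :
    walkMultiplier ξ ^ t ≤
      ∏ i, Real.exp (-(t * (1 - (ZMod.stdAddChar (ξ i) : ℂ).re) / (2 * d))) := by
  have hd' : (0 : ℝ) < d := by exact_mod_cast hd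
  calc walkMultiplier ξ ^ t ≤ Real.exp (walkMultiplier ξ - 1) ^ t := by
        refine pow_le_pow_left₀ (walkMultiplier_nonneg ξ) ?_ t
        linarith [Real.add_one_le_exp (walkMultiplier ξ - 1)]
    _ = _ := by
        rw [← Real.exp_nat_mul, ← Real.exp_sum]
        congr 1
        rw [Finset.sum_neg_distrib, ← Finset.sum_div, ← Finset.mul_sum, Finset.sum_sub_distrib,
          Finset.sum_const, Finset.card_univ, Fintype.card_fin, nsmul_eq_mul, walkMultiplier]
        field_simp
        ring

theorem stdAddChar_re_le {L : ℕ} [NeZero L] (a : ZMod L) :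
    (ZMod.stdAddChar a : ℂ).re ≤ 1 - 8 * (a.valMinAbs.natAbs : ℝ) ^ 2 / L ^ 2 := by
  have hL : (0 : ℝ) < L := by exact_mod_cast NeZero.pos L
  have h1 : (ZMod.stdAddChar a : ℂ).re = Real.cos (2 * Real.pi * a.valMinAbs / L) := by
    conv_lhs => rw [← ZMod.coe_valMinAbs a, ZMod.stdAddChar_coe]
    rw [← Complex.exp_ofReal_mul_I_re]
    congr 2
    push_cast
    ring
  have hsq : ((a.valMinAbs.natAbs : ℝ)) ^ 2 = (a.valMinAbs : ℝ) ^ 2 := by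
    rw [Nat.cast_natAbs, Int.cast_abs, sq_abs]
  rw [h1, hsq]
  have h2 : |(2 * Real.pi * a.valMinAbs / L : ℝ)| ≤ Real.pi := by
    have h3 := ZMod.natAbs_valMinAbs_le a
    have h4 : 2 * a.valMinAbs.natAbs ≤ L := by omega
    have h5 : 2 * |(a.valMinAbs : ℝ)| ≤ L := by
      rw [← Int.cast_abs, ← Nat.cast_natAbs]
      exact_mod_cast h4
    rw [abs_div, abs_mul, abs_of_pos hL, abs_of_pos Real.two_pi_pos, div_le_iff₀ hL]
    nlinarith [Real.pi_pos]
  refine (Real.cos_le_one_sub_mul_cos_sq h2).trans (le_of_eq ?_)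
  have := Real.pi_ne_zero
  field_simp
  ring

theorem sum_sq_div_le {r : ℝ} (hr : 1 ≤ r) (N : ℕ) :
    ∑ m ∈ Finset.range N, r ^ 2 / (r ^ 2 + ((m : ℝ) + 1) ^ 2) ≤ 2 * r := by
  have h : ∑ m ∈ Finset.range N, r ^ 2 / (r ^ 2 + ((m : ℝ) + 1) ^ 2) ≤
      2 * r ^ 2 * (1 / r - 1 / (r + N)) := by
    induction N with
    | zero => simp
    | succ N ih =>
      rw [Finset.sum_range_succ]
      have hN : (0 : ℝ) ≤ N := Nat.cast_nonneg N
      have h1 : r ^ 2 / (r ^ 2 + ((N : ℝ) + 1) ^ 2) ≤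
          2 * r ^ 2 * (1 / (r + N) - 1 / (r + (N + 1 : ℕ))) := by
        have h2 : (1 : ℝ) / (r + N) - 1 / (r + (N + 1 : ℕ)) =
            1 / ((r + N) * (r + N + 1)) := by
          push_cast
          field_simp
          ring
        rw [h2, mul_one_div, div_le_div_iff₀ (by positivity) (by positivity)]
        have h3 : (r + N) * (r + N + 1) ≤ 2 * (r ^ 2 + ((N : ℝ) + 1) ^ 2) := by
          nlinarith [sq_nonneg (r - (N + 1))]
        nlinarith [mul_le_mul_of_nonneg_left h3 (sq_nonneg r)]
      linarith
  refine h.trans ?_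
  have h1 : 0 ≤ 1 / (r + N) := by positivity
  have h2 : 2 * r ^ 2 * (1 / r) = 2 * r := by field_simp
  nlinarith [mul_nonneg (by positivity : 0 ≤ 2 * r ^ 2) h1]

theorem sum_valMinAbs_le {L : ℕ} [NeZero L] {F : ℕ → ℝ} (hF : ∀ m, 0 ≤ F m) :
    ∑ a : ZMod L, F a.valMinAbs.natAbs ≤ F 0 + 2 * ∑ m ∈ Finset.range L, F (m + 1) := by
  have h1 : ∀ G : ℕ → ℝ, ∑ a : ZMod L, G a.val = ∑ m ∈ Finset.range L, G m := by
    intro G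
    obtain ⟨n, rfl⟩ := Nat.exists_eq_succ_of_ne_zero (NeZero.ne L)
    exact Fin.sum_univ_eq_sum_range G (n + 1)
  calc ∑ a : ZMod L, F a.valMinAbs.natAbs ≤ ∑ a : ZMod L, (F a.val + F (L - a.val)) := by
        refine Finset.sum_le_sum fun a _ => ?_
        rw [ZMod.valMinAbs_natAbs_eq_min]
        rcases min_choice a.val (L - a.val) with h | h <;> rw [h]
        · exact le_add_of_nonneg_right (hF _)
        · exact le_add_of_nonneg_left (hF _)
    _ = ∑ m ∈ Finset.range L, F m + ∑ m ∈ Finset.range L, F (m + 1) := by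
        rw [h1 fun m => F m + F (L - m), Finset.sum_add_distrib]
        congr 1
        rw [← Finset.sum_range_reflect]
        refine Finset.sum_congr rfl fun m hm => ?_
        rw [Finset.mem_range] at hm
        congr 1
        omega
    _ ≤ _ := by
        have h2 : ∑ m ∈ Finset.range L, F m ≤ ∑ m ∈ Finset.range (L + 1), F m := by
          rw [Finset.sum_range_succ]
          exact le_add_of_nonneg_right (hF _)
        rw [Finset.sum_range_succ'] at h2
        linarith

theorem sum_exp_stdAddChar_le {L d t : ℕ} [NeZero L] (hd : 0 < d) (ht : 0 < t) (htL : t ≤ L ^ 2) :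
    ∑ a : ZMod L, Real.exp (-(t * (1 - (ZMod.stdAddChar a : ℂ).re) / (2 * d))) ≤
      5 * d * (L / √t) := by
  have hL : (0 : ℝ) < L := by exact_mod_cast NeZero.pos L
  have hd' : (1 : ℝ) ≤ d := by exact_mod_cast hd
  have ht' : (0 : ℝ) < t := by exact_mod_cast ht
  set r := L / √(t : ℝ) with hr
  have hsqrt : 0 < √(t : ℝ) := Real.sqrt_pos.2 ht'
  have hr1 : 1 ≤ r := by
    rw [hr, one_le_div hsqrt]
    exact Real.sqrt_le_iff.2 ⟨hL.le, by exact_mod_cast htL⟩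
  have hr2 : r ^ 2 = L ^ 2 / t := by rw [hr, div_pow, Real.sq_sqrt ht'.le]
  have h1 : ∀ a : ZMod L, Real.exp (-(t * (1 - (ZMod.stdAddChar a : ℂ).re) / (2 * d))) ≤
      Real.exp (-(4 * (a.valMinAbs.natAbs : ℝ) ^ 2 / (d * r ^ 2))) := by
    intro a
    rw [Real.exp_le_exp, neg_le_neg_iff, hr2]
    have := stdAddChar_re_le a
    calc 4 * (a.valMinAbs.natAbs : ℝ) ^ 2 / (d * (L ^ 2 / t)) =
          t * (8 * (a.valMinAbs.natAbs : ℝ) ^ 2 / L ^ 2) / (2 * d) := by field_simp; ring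
      _ ≤ _ := by gcongr; linarith
  have h2 : ∀ m : ℕ, Real.exp (-(4 * ((m + 1 : ℕ) : ℝ) ^ 2 / (d * r ^ 2))) ≤
      d * (r ^ 2 / (r ^ 2 + ((m : ℝ) + 1) ^ 2)) := by
    intro m
    rw [Real.exp_neg, inv_le_comm₀ (Real.exp_pos _) (by positivity)]
    refine le_trans ?_ (Real.add_one_le_exp _)
    push_cast
    rw [← mul_div_assoc, inv_div, div_add_one (by positivity)]
    refine div_le_div_of_nonneg_right ?_ (by positivity)
    nlinarith [mul_le_mul_of_nonneg_right hd' (sq_nonneg r), sq_nonneg ((m : ℝ) + 1)]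
  calc _ ≤ ∑ a : ZMod L, Real.exp (-(4 * (a.valMinAbs.natAbs : ℝ) ^ 2 / (d * r ^ 2))) :=
        Finset.sum_le_sum fun a _ => h1 a
    _ ≤ Real.exp (-(4 * ((0 : ℕ) : ℝ) ^ 2 / (d * r ^ 2))) +
        2 * ∑ m ∈ Finset.range L, Real.exp (-(4 * ((m + 1 : ℕ) : ℝ) ^ 2 / (d * r ^ 2))) :=
        sum_valMinAbs_le (F := fun m => Real.exp (-(4 * (m : ℝ) ^ 2 / (d * r ^ 2))))
          fun m => (Real.exp_pos _).le
    _ ≤ 1 + 2 * (d * (2 * r)) := by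
        refine add_le_add (by simp) (mul_le_mul_of_nonneg_left ?_ (by norm_num))
        refine (Finset.sum_le_sum fun m _ => h2 m).trans ?_
        rw [← Finset.mul_sum]
        exact mul_le_mul_of_nonneg_left (sum_sq_div_le hr1 L) (by linarith)
    _ ≤ 5 * d * r := by nlinarith

theorem heatKernel_le {L d t : ℕ} [NeZero L] (hd : 0 < d) (ht : 0 < t) (htL : t ≤ L ^ 2)
    (z : Fin d → ZMod L) : heatKernel L d t z ≤ (5 * d / √t) ^ d := by
  have hL : (0 : ℝ) < L := by exact_mod_cast NeZero.pos L
  have h1 : heatKernel L d t z ≤ ((L : ℝ) ^ d)⁻¹ * ∑ ξ : Fin d → ZMod L, walkMultiplier ξ ^ t := by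
    calc heatKernel L d t z = ‖(heatKernel L d t z : ℂ)‖ := by
          rw [Complex.norm_real, Real.norm_of_nonneg (heatKernel_nonneg L d t z)]
      _ ≤ _ := by
          rw [heatKernel_eq_sum, norm_mul, norm_inv, norm_pow, Complex.norm_natCast]
          refine mul_le_mul_of_nonneg_left (norm_sum_le_of_le _ fun ξ _ => ?_) (by positivity)
          rw [norm_mul, norm_pow, Complex.norm_real,
            Real.norm_of_nonneg (walkMultiplier_nonneg ξ), norm_prod]
          simp
  have h2 : ∑ ξ : Fin d → ZMod L, walkMultiplier ξ ^ t ≤ (5 * d * (L / √t)) ^ d := by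
    calc _ ≤ ∑ ξ : Fin d → ZMod L,
          ∏ i, Real.exp (-(t * (1 - (ZMod.stdAddChar (ξ i) : ℂ).re) / (2 * d))) :=
          Finset.sum_le_sum fun ξ _ => walkMultiplier_pow_le hd t ξ
      _ = ∏ _i : Fin d, ∑ a : ZMod L,
          Real.exp (-(t * (1 - (ZMod.stdAddChar a : ℂ).re) / (2 * d))) := by
          rw [Finset.prod_univ_sum, Fintype.piFinset_univ]
      _ ≤ ∏ _i : Fin d, (5 * d * (L / √t)) := by
          refine Finset.prod_le_prod (fun _ _ => Finset.sum_nonneg fun a _ => (Real.exp_pos _).le)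
            fun _ _ => sum_exp_stdAddChar_le hd ht htL
      _ = _ := by simp
  calc heatKernel L d t z ≤ ((L : ℝ) ^ d)⁻¹ * (5 * d * (L / √t)) ^ d :=
        h1.trans (mul_le_mul_of_nonneg_left h2 (by positivity))
    _ = _ := by
        rw [← inv_pow, ← mul_pow]
        congr 1
        field_simp

/-- The Green function of the lazy walk on the torus, run for `L ^ 2` steps. -/
def torusGreen (L d : ℕ) (u v : Fin d → ZMod L) : ℝ :=
  ∑ t ∈ Finset.range (L ^ 2), heatKernel L d t (u - v)

theorem isInteraction_torusGreen {L d : ℕ} [NeZero L] (hL : 3 ≤ L) (hd : 0 < d) :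
    IsInteraction (torusGraph L d) (torusGreen L d) (1 / (4 * d) ^ 2)
      (4 * d * (5 * d) ^ d / Fintype.card (Fin d → ZMod L)) := by
  have hd' : (1 : ℝ) ≤ d := by exact_mod_cast hd
  have hL' : (0 : ℝ) < L := by exact_mod_cast NeZero.pos L
  have hL9 : 9 ≤ L ^ 2 := by nlinarith
  have hadj : ∀ {u v w : Fin d → ZMod L}, (torusGraph L d).Adj u w →
      (torusGraph L d).Adj (u - v) (w - v) := by
    intro u v w h
    rw [torusGraph_adj_iff (by omega)] at h ⊢
    obtain ⟨i, rfl | rfl⟩ := h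
    · exact ⟨i, Or.inl (by abel)⟩
    · exact ⟨i, Or.inr (by abel)⟩
  have hone : ∀ u v : Fin d → ZMod L, (torusGraph L d).Adj u v →
      1 / (4 * d) ≤ heatKernel L d 1 (u - v) := by
    intro u v h
    have := heatKernel_le_succ (by omega) 0 (hadj (v := v) h)
    simpa [heatKernel] using this
  have hsingle : ∀ t < L ^ 2, ∀ u v : Fin d → ZMod L,
      heatKernel L d t (u - v) ≤ torusGreen L d u v := fun t ht u v =>
    Finset.single_le_sum (f := fun t => heatKernel L d t (u - v))
      (fun t _ => heatKernel_nonneg L d t _) (Finset.mem_range.2 ht)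
  refine ⟨fun u v => Finset.sum_nonneg fun t _ => heatKernel_nonneg _ _ _ _, fun u v => ?_,
    by positivity, fun u v h => ?_, fun u v w _ huw hwv => ?_, by positivity, fun u v huv => ?_⟩
  · refine Finset.sum_congr rfl fun t _ => ?_
    rw [← heatKernel_neg, neg_sub]
  · refine le_trans ?_ ((hone u v h).trans (hsingle 1 (by omega) u v))
    exact one_div_le_one_div_of_le (by positivity) (by nlinarith)
  · refine le_trans ?_ (hsingle 2 (by omega) u v)
    refine le_trans ?_ (heatKernel_le_succ (by omega) 1 (hadj huw))
    calc 1 / (4 * d : ℝ) ^ 2 = 1 / (4 * d) / (4 * d) := by field_simp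
      _ ≤ _ := by gcongr; exact hone w v hwv
  · rw [sum_torusGraph_adj hL v fun w => torusGreen L d w u - torusGreen L d v u]
    have hd0 : (d : ℝ) ≠ 0 := by positivity
    have key : ∑ i, (torusGreen L d (v + Pi.single i 1) u - torusGreen L d v u +
        (torusGreen L d (v - Pi.single i 1) u - torusGreen L d v u)) =
        4 * d * ∑ t ∈ Finset.range (L ^ 2),
          (heatKernel L d (t + 1) (v - u) - heatKernel L d t (v - u)) := by
      simp only [torusGreen, heatKernel]
      have e1 : ∀ i : Fin d, v + Pi.single i 1 - u = v - u + Pi.single i 1 := fun i => by abel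
      have e2 : ∀ i : Fin d, v - Pi.single i 1 - u = v - u - Pi.single i 1 := fun i => by abel
      simp_rw [e1, e2, ← Finset.sum_sub_distrib, ← Finset.sum_add_distrib]
      rw [Finset.sum_comm, Finset.mul_sum]
      refine Finset.sum_congr rfl fun t _ => ?_
      simp_rw [sub_add_sub_comm]
      rw [Finset.sum_sub_distrib, Finset.sum_const, Finset.card_univ, Fintype.card_fin,
        nsmul_eq_mul]
      field_simp
      ring
    rw [key, Finset.sum_range_sub fun t => heatKernel L d t (v - u)]
    have h0 : heatKernel L d 0 (v - u) = 0 := by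
      simp [heatKernel, sub_eq_zero, huv.symm]
    have h1 := heatKernel_le hd (by positivity) le_rfl (v - u) (t := L ^ 2)
    have h2 : √((L ^ 2 : ℕ) : ℝ) = L := by
      push_cast
      exact Real.sqrt_sq hL'.le
    rw [h2, div_pow] at h1
    rw [h0, sub_zero, Fintype.card_pi, Finset.prod_const, Finset.card_univ, Fintype.card_fin,
      ZMod.card, mul_div_assoc]
    push_cast
    gcongr

theorem exists_torusGreen_le {d : ℕ} (hd : 3 ≤ d) {η : ℝ} (hη : 0 < η) :
    ∃ R : ℕ, ∀ (L : ℕ) [NeZero L] (u v : Fin d → ZMod L) (j : Fin d),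
      (∀ m : ℤ, |m| ≤ R → u j - v j ≠ m) → torusGreen L d u v ≤ η := by
  have hsum : Summable fun t : ℕ => (5 * d : ℝ) ^ d * (1 / (t : ℝ) ^ ((3 : ℝ) / 2)) :=
    (Real.summable_one_div_nat_rpow.2 (by norm_num)).mul_left _
  obtain ⟨s, hs⟩ := summable_iff_vanishing_norm.1 hsum η hη
  refine ⟨s.sup id, fun L _ u v j h => ?_⟩
  have hR : ∀ t ∈ s, t ≤ s.sup id := fun t ht => Finset.le_sup (f := id) ht
  set R := s.sup id
  set A := (Finset.range (L ^ 2)).filter fun t => R < t with hA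
  have hdisj : Disjoint A s := by
    rw [Finset.disjoint_left]
    intro t ht hts
    rw [hA, Finset.mem_filter] at ht
    exact absurd (hR t hts) (not_le.2 ht.2)
  have h1 : torusGreen L d u v = ∑ t ∈ A, heatKernel L d t (u - v) := by
    unfold torusGreen
    refine (Finset.sum_subset (Finset.filter_subset _ _) fun t ht htA => ?_).symm
    refine heatKernel_eq_zero t j _ fun m hm => h m (hm.trans ?_)
    by_contra hlt
    refine htA (Finset.mem_filter.2 ⟨ht, ?_⟩)
    push Not at hlt
    exact_mod_cast hlt
  rw [h1]
  refine le_trans ?_ ((le_abs_self _).trans (hs A hdisj).le)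
  refine Finset.sum_le_sum fun t ht => ?_
  rw [hA, Finset.mem_filter, Finset.mem_range] at ht
  have ht0 : 0 < t := by omega
  have ht1 : (1 : ℝ) ≤ t := by exact_mod_cast ht0
  have hsq : 1 ≤ √(t : ℝ) := Real.one_le_sqrt.2 ht1
  have h2 : (t : ℝ) ^ ((3 : ℝ) / 2) = √(t : ℝ) ^ 3 := by
    rw [Real.sqrt_eq_rpow, ← Real.rpow_natCast, ← Real.rpow_mul (by linarith)]
    norm_num
  refine (heatKernel_le (by omega) ht0 ht.1.le (u - v)).trans ?_
  rw [div_pow, h2, div_eq_mul_one_div]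
  gcongr

/-! ### Spreading the particles apart -/

/-- The configuration whose particles sit at the points `f i`. -/
def configOf {V : Type*} {k : ℕ} (f : Fin k → V) (v : V) : Bool := decide (∃ i, f i = v)

theorem configOf_eq_true {V : Type*} {k : ℕ} {f : Fin k → V} {v : V} :
    configOf f v = true ↔ ∃ i, f i = v := decide_eq_true_iff

theorem configOf_eq_false {V : Type*} {k : ℕ} {f : Fin k → V} {v : V} :
    configOf f v = false ↔ ∀ i, f i ≠ v := by
  rw [← Bool.not_eq_true, configOf_eq_true, not_exists]

theorem configOf_mem_OmegaK {V : Type*} [Fintype V] {G : SimpleGraph V} {k : ℕ} {f : Fin k → V}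
    (hf : Function.Injective f) (hadj : ∀ i j, ¬G.Adj (f i) (f j)) :
    configOf f ∈ OmegaK G k := by
  constructor
  · have : (Finset.univ.filter fun v => configOf f v = true) = Finset.univ.image f := by
      ext v
      simp [configOf_eq_true]
    rw [numParticles, this, Finset.card_image_of_injective _ hf, Finset.card_univ,
      Fintype.card_fin]
  · rintro u v huv ⟨hu, hv⟩
    obtain ⟨i, rfl⟩ := configOf_eq_true.1 hu
    obtain ⟨j, rfl⟩ := configOf_eq_true.1 hv
    exact hadj i j huv

theorem isMove_configOf {V : Type*} [Fintype V] {G : SimpleGraph V} {k : ℕ} {f f' : Fin k → V}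
    (hf : Function.Injective f) (hadj : ∀ i j, ¬G.Adj (f i) (f j)) (hf' : Function.Injective f')
    {i : Fin k} (hi : G.Adj (f i) (f' i)) (hne : ∀ j, j ≠ i → f' j = f j) :
    IsMove G k (configOf f) (configOf f') (f i) (f' i) := by
  have hfi : ∀ j, f j ≠ f' i := by
    intro j h
    by_cases hj : j = i
    · subst hj
      exact hi.ne h
    · rw [← hne j hj] at h
      exact hj (hf' h)
  refine ⟨configOf_mem_OmegaK hf hadj, hi, configOf_eq_true.2 ⟨i, rfl⟩, configOf_eq_false.2 hfi, ?_⟩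
  funext v
  by_cases hv : v = f i
  · subst hv
    rw [Function.update_self, configOf_eq_false]
    intro j h
    by_cases hj : j = i
    · subst hj
      exact hi.ne h.symm
    · rw [hne j hj] at h
      exact hj (hf h)
  · rw [Function.update_of_ne hv]
    by_cases hv' : v = f' i
    · subst hv'
      rw [Function.update_self, configOf_eq_true]
      exact ⟨i, rfl⟩
    · rw [Function.update_of_ne hv', Bool.eq_iff_iff, configOf_eq_true, configOf_eq_true]
      refine exists_congr fun j => ?_
      by_cases hj : j = i
      · subst hj
        exact iff_of_false (Ne.symm hv') (Ne.symm hv)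
      · rw [hne j hj]

theorem val_add_natCast {L : ℕ} [NeZero L] {a : ZMod L} {r : ℕ} (h : a.val + r < L) :
    (a + r).val = a.val + r := by
  have hr : (r : ZMod L).val = r := ZMod.val_natCast_of_lt (by omega)
  rw [ZMod.val_add_of_lt (by rwa [hr]), hr]

theorem ne_and_not_adj_of_le {L d : ℕ} [NeZero L] (hL : 2 ≤ L) {u v : Fin d → ZMod L} (j : Fin d)
    (s : ZMod L) (hab : (u j - s).val ≤ (v j - s).val) (hne : u ≠ v)
    (hadj : ¬(torusGraph L d).Adj u v) (r : ℕ) (hr : (v j - s).val + r + 1 < L) :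
    u ≠ v + Pi.single j (r : ZMod L) ∧
      ¬(torusGraph L d).Adj u (v + Pi.single j (r : ZMod L)) := by
  have hv : ((v + Pi.single j (r : ZMod L) : Fin d → ZMod L) j - s).val = (v j - s).val + r := by
    rw [← val_add_natCast (by omega), Pi.add_apply, Pi.single_eq_same]
    congr 1
    ring
  have hr0 : r = 0 → v + Pi.single j (r : ZMod L) = v := by
    rintro rfl
    simp
  constructor
  · intro h
    rw [← h] at hv
    exact hne (h.trans (hr0 (by omega)))
  · intro h
    obtain ⟨i, hi⟩ := (torusGraph_adj_iff hL).1 h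
    by_cases hij : j = i
    · subst hij
      rcases hi with hi | hi
      · have hu : ((u + Pi.single j (1 : ZMod L) : Fin d → ZMod L) j - s).val =
            (u j - s).val + 1 := by
          rw [← val_add_natCast (by omega), Pi.add_apply, Pi.single_eq_same]
          congr 1
          push_cast
          ring
        rw [← hi, hv] at hu
        obtain rfl | rfl : r = 0 ∨ r = 1 := by omega
        · rw [hr0 rfl] at h
          exact hadj h
        · rw [Nat.cast_one] at hi
          exact hne (add_right_cancel hi).symm
      · have hu : u j - s = (v j - s) + ((r + 1 : ℕ) : ZMod L) := by
          have := congrFun hi j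
          rw [Pi.add_apply, Pi.sub_apply, Pi.single_eq_same, Pi.single_eq_same] at this
          push_cast
          linear_combination -this
        have := val_add_natCast (a := v j - s) (r := r + 1) (by omega)
        rw [← hu] at this
        omega
    · have hj : (v + Pi.single j (r : ZMod L) : Fin d → ZMod L) j = u j := by
        rcases hi with hi | hi <;> rw [hi] <;> simp [hij]
      rw [hj] at hv
      rw [hr0 (by omega)] at h
      exact hadj h

theorem ne_and_not_adj_shift {L d : ℕ} [NeZero L] (hL : 2 ≤ L) {u v : Fin d → ZMod L} (j : Fin d)
    (s : ZMod L) (hab : (u j - s).val ≤ (v j - s).val) (hne : u ≠ v)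
    (hadj : ¬(torusGraph L d).Adj u v) {p q : ℕ} (hpq : p ≤ q)
    (hq : (v j - s).val + q + 1 < L) :
    u + Pi.single j (p : ZMod L) ≠ v + Pi.single j (q : ZMod L) ∧
      ¬(torusGraph L d).Adj (u + Pi.single j (p : ZMod L)) (v + Pi.single j (q : ZMod L)) := by
  obtain ⟨r, rfl⟩ := Nat.exists_eq_add_of_le hpq
  obtain ⟨h1, h2⟩ := ne_and_not_adj_of_le hL j s hab hne hadj r (by omega)
  have hr : v + Pi.single j ((p + r : ℕ) : ZMod L) =
      v + Pi.single j (r : ZMod L) + Pi.single j (p : ZMod L) := by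
    rw [add_assoc, ← Pi.single_add]
    push_cast
    rw [add_comm (r : ZMod L)]
  rw [hr]
  refine ⟨fun h => h1 (add_right_cancel h), fun h => h2 ?_⟩
  rw [torusGraph_adj_iff hL] at h ⊢
  obtain ⟨i, hi | hi⟩ := h
  · refine ⟨i, Or.inl (add_right_cancel (b := Pi.single j (p : ZMod L)) ?_)⟩
    rw [hi, add_right_comm]
  · refine ⟨i, Or.inr (add_right_cancel (b := Pi.single j (p : ZMod L)) ?_)⟩
    rw [hi, sub_add_eq_add_sub]

/-- The family `f` with its `i`-th point moved by `o i` steps in direction `j`. -/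
def shiftBy {L d k : ℕ} (j : Fin d) (f : Fin k → Fin d → ZMod L) (o : Fin k → ℕ) (i : Fin k) :
    Fin d → ZMod L :=
  f i + Pi.single j (o i : ZMod L)

section Shift

variable {L d k : ℕ} [NeZero L] {j : Fin d} {s : ZMod L} {f : Fin k → Fin d → ZMod L}

theorem shiftBy_separated (hL : 2 ≤ L) (hf : Function.Injective f)
    (hadj : ∀ i i', ¬(torusGraph L d).Adj (f i) (f i'))
    (hs : Monotone fun i => (f i j - s).val) {o : Fin k → ℕ} (ho : Monotone o)
    (hoL : ∀ i, (f i j - s).val + o i + 1 < L) :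
    Function.Injective (shiftBy j f o) ∧
      ∀ i i', ¬(torusGraph L d).Adj (shiftBy j f o i) (shiftBy j f o i') := by
  have key : ∀ i i', i < i' → shiftBy j f o i ≠ shiftBy j f o i' ∧
      ¬(torusGraph L d).Adj (shiftBy j f o i) (shiftBy j f o i') := fun i i' h =>
    ne_and_not_adj_shift hL j s (hs h.le) (hf.ne h.ne) (hadj i i') (ho h.le) (hoL i')
  constructor
  · intro i i' h
    rcases lt_trichotomy i i' with hlt | heq | hlt
    · exact absurd h (key i i' hlt).1
    · exact heq
    · exact absurd h.symm (key i' i hlt).1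
  · intro i i' h
    rcases lt_trichotomy i i' with hlt | heq | hlt
    · exact (key i i' hlt).2 h
    · subst heq
      exact h.ne rfl
    · exact (key i' i hlt).2 h.symm

theorem pow_mul_le_of_isMove (hL : 2 ≤ L) (hf : Function.Injective f)
    (hadj : ∀ i i', ¬(torusGraph L d).Adj (f i) (f i'))
    (hs : Monotone fun i => (f i j - s).val) {P : ℕ → ((Fin d → ZMod L) → Bool) → ℝ} {q : ℝ}
    (hq : 0 ≤ q) {M : ℕ}
    (hP : ∀ x y v w, IsMove (torusGraph L d) k x y v w → ∀ T, q * P T y ≤ P (T + M) x)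
    {o : Fin k → ℕ} (ho : Monotone o) (hoL : ∀ i, (f i j - s).val + o i + 1 < L) (T : ℕ) :
    q ^ (∑ i, o i) * P T (configOf (shiftBy j f o)) ≤ P (T + (∑ i, o i) * M) (configOf f) := by
  induction hN : ∑ i, o i generalizing o T with
  | zero =>
    have h0 : ∀ i, o i = 0 := fun i => by
      simpa using (Finset.sum_eq_zero_iff.1 hN) i (Finset.mem_univ i)
    have : shiftBy j f o = f := by
      funext i
      simp [shiftBy, h0 i]
    simp [this]
  | succ N ih =>
    have hex : ∃ i, 0 < o i := by
      by_contra! h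
      have : ∑ i, o i = 0 := Finset.sum_eq_zero fun i _ => Nat.le_zero.1 (h i)
      omega
    obtain ⟨i, hi, hmin⟩ := WellFounded.has_min (wellFounded_lt (α := Fin k)) {i | 0 < o i} hex
    have hmin' : ∀ i' < i, o i' = 0 := fun i' h => by
      by_contra h0
      exact hmin i' (Nat.pos_of_ne_zero h0) h
    set o' := Function.update o i (o i - 1) with ho'
    have hle : ∀ i', o' i' ≤ o i' := by
      intro i'
      by_cases h : i' = i
      · subst h; simp [ho']
      · simp [ho', h]
    have hmono : Monotone o' := by
      intro a b hab
      by_cases hb : b = i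
      · subst hb
        rcases hab.lt_or_eq with h | h
        · have := hle a
          rw [hmin' a h] at this
          omega
        · rw [h]
      · refine (hle a).trans ((ho hab).trans (le_of_eq ?_))
        simp [ho', hb]
    have hoi : o i = o' i + 1 := by
      simp only [ho', Function.update_self]
      have : 0 < o i := hi
      omega
    have hsum : ∑ i, o' i = N := by
      have h1 := Finset.add_sum_erase Finset.univ o (Finset.mem_univ i)
      have h2 := Finset.add_sum_erase Finset.univ o' (Finset.mem_univ i)
      have h3 : ∑ a ∈ Finset.univ.erase i, o' a = ∑ a ∈ Finset.univ.erase i, o a :=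
        Finset.sum_congr rfl fun a ha => by simp [ho', (Finset.mem_erase.1 ha).1]
      omega
    have hoL' : ∀ i, (f i j - s).val + o' i + 1 < L := fun i => by
      have := hle i
      have := hoL i
      omega
    obtain ⟨hinj', hadj'⟩ := shiftBy_separated hL hf hadj hs hmono hoL'
    have hmove : IsMove (torusGraph L d) k (configOf (shiftBy j f o')) (configOf (shiftBy j f o))
        (shiftBy j f o' i) (shiftBy j f o i) := by
      refine isMove_configOf hinj' hadj' (shiftBy_separated hL hf hadj hs ho hoL).1 ?_ ?_
      · refine (torusGraph_adj_iff hL).2 ⟨j, Or.inl ?_⟩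
        rw [shiftBy, shiftBy, hoi, Nat.cast_add, Pi.single_add, Nat.cast_one, add_assoc]
      · intro a ha
        simp [shiftBy, ho', ha]
    calc q ^ (N + 1) * P T (configOf (shiftBy j f o)) =
          q ^ N * (q * P T (configOf (shiftBy j f o))) := by ring
      _ ≤ q ^ N * P (T + M) (configOf (shiftBy j f o')) :=
          mul_le_mul_of_nonneg_left (hP _ _ _ _ hmove T) (pow_nonneg hq N)
      _ ≤ P (T + M + N * M) (configOf f) := ih hmono hoL' (T + M) hsum
      _ = P (T + (N + 1) * M) (configOf f) := by
          congr 1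
          ring

end Shift

theorem exists_cut {L k H : ℕ} [NeZero L] (h : k * H < L) (g : Fin k → ZMod L) :
    ∃ s : ZMod L, ∀ i, (g i - s).val + H < L := by
  have hns : ¬Function.Surjective fun q : Fin k × Fin H => g q.1 + ((q.2 : ℕ) + 1 : ℕ) := by
    intro hsurj
    have := Fintype.card_le_of_surjective _ hsurj
    rw [ZMod.card, Fintype.card_prod, Fintype.card_fin, Fintype.card_fin] at this
    omega
  simp only [Function.Surjective, not_forall, not_exists] at hns
  obtain ⟨s, hs⟩ := hns
  refine ⟨s, fun i => ?_⟩
  by_contra! hle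
  have hlt := ZMod.val_lt (g i - s)
  refine hs (i, ⟨L - 1 - (g i - s).val, by omega⟩) ?_
  have h1 : (g i - s) + ((L - 1 - (g i - s).val + 1 : ℕ) : ZMod L) = 0 := by
    conv_lhs => rw [← ZMod.natCast_zmod_val (g i - s)]
    rw [← Nat.cast_add, ZMod.natCast_zmod_val,
      show (g i - s).val + (L - 1 - (g i - s).val + 1) = L by omega, ZMod.natCast_self]
  linear_combination h1

theorem exists_spread {L d K k R : ℕ} [NeZero L] (hd : 0 < d) (hk : k ≤ K)
    (hL : (K + 1) * ((K + 1) * (R + 1) + 1) < L)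
    {x : (Fin d → ZMod L) → Bool} (hx : x ∈ OmegaK (torusGraph L d) k) :
    ∃ (y : (Fin d → ZMod L) → Bool) (m : ℕ), y ∈ OmegaK (torusGraph L d) k ∧
      m ≤ K * (K * (R + 1)) ∧
      (∀ u v, y u = true → y v = true → u ≠ v →
        ∃ j, ∀ z : ℤ, |z| ≤ R → u j - v j ≠ z) ∧
      ∀ (P : ℕ → ((Fin d → ZMod L) → Bool) → ℝ) (q : ℝ) (M : ℕ), 0 ≤ q →
        (∀ x y v w, IsMove (torusGraph L d) k x y v w → ∀ T, q * P T y ≤ P (T + M) x) →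
        ∀ T, q ^ m * P T y ≤ P (T + m * M) x := by
  set H := (K + 1) * (R + 1) + 1 with hH
  have hHK : K * (R + 1) + R + 2 = H := by rw [hH]; ring
  have hL2 : 2 ≤ L := by nlinarith
  set j : Fin d := ⟨0, hd⟩
  set g : Fin k → Fin d → ZMod L :=
    fun i => ((Finset.univ.filter fun v => x v = true).equivFinOfCardEq hx.1).symm i with hg
  have hgx : ∀ v, x v = true ↔ ∃ i, g i = v := by
    intro v
    constructor
    · intro hv
      refine ⟨(Finset.univ.filter fun v => x v = true).equivFinOfCardEq hx.1
        ⟨v, by simpa using hv⟩, ?_⟩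
      simp [hg]
    · rintro ⟨i, rfl⟩
      exact (Finset.mem_filter.1
        (((Finset.univ.filter fun v => x v = true).equivFinOfCardEq hx.1).symm i).2).2
  have hginj : Function.Injective g := Subtype.val_injective.comp (Equiv.injective _)
  obtain ⟨s, hs⟩ := exists_cut (H := H)
    (lt_of_le_of_lt (Nat.mul_le_mul_right H (by omega : k ≤ K + 1)) hL) fun i => g i j
  set σ := Tuple.sort fun i => (g i j - s).val
  set f : Fin k → Fin d → ZMod L := fun i => g (σ i) with hf
  have hfmono : Monotone fun i => (f i j - s).val := Tuple.monotone_sort fun i => (g i j - s).val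
  have hfinj : Function.Injective f := hginj.comp σ.injective
  have hfx : configOf f = x := by
    funext v
    rw [Bool.eq_iff_iff, configOf_eq_true, hgx]
    exact ⟨fun ⟨i, hi⟩ => ⟨σ i, hi⟩, fun ⟨i, hi⟩ => ⟨σ.symm i, by simpa [hf] using hi⟩⟩
  have hfadj : ∀ i i', ¬(torusGraph L d).Adj (f i) (f i') := fun i i' h =>
    hx.2 _ _ h ⟨(hgx _).2 ⟨_, rfl⟩, (hgx _).2 ⟨_, rfl⟩⟩
  have hfH : ∀ i, (f i j - s).val + H < L := fun i => hs (σ i)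
  set o : Fin k → ℕ := fun i => i * (R + 1) with ho
  have homono : Monotone o := fun a b hab => Nat.mul_le_mul_right _ hab
  have hoK : ∀ i, o i ≤ K * (R + 1) := fun i => Nat.mul_le_mul_right _ (by omega)
  have hoL : ∀ i, (f i j - s).val + o i + 1 < L := fun i => by
    have := hfH i
    have := hoK i
    omega
  obtain ⟨hinj, hadj⟩ := shiftBy_separated hL2 hfinj hfadj hfmono homono hoL
  refine ⟨configOf (shiftBy j f o), ∑ i, o i, configOf_mem_OmegaK hinj hadj, ?_, ?_, ?_⟩
  · refine (Finset.sum_le_card_nsmul _ _ _ fun i _ => hoK i).trans ?_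
    rw [Finset.card_univ, Fintype.card_fin, smul_eq_mul]
    exact Nat.mul_le_mul_right _ hk
  · have key : ∀ i i', i < i' → ∀ z : ℤ, |z| ≤ R →
        shiftBy j f o i' j - shiftBy j f o i j ≠ z := by
      intro i i' hlt z hz h
      set a := (f i j - s).val with ha
      set b := (f i' j - s).val with hb
      have hab : a ≤ b := hfmono hlt.le
      have hoo : o i + (R + 1) ≤ o i' := by
        have h1 : (i : ℕ) + 1 ≤ i' := hlt
        calc o i + (R + 1) = ((i : ℕ) + 1) * (R + 1) := by rw [ho]; ring
          _ ≤ o i' := Nat.mul_le_mul_right _ h1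
      have hfi : f i j = s + (a : ZMod L) := by
        rw [ha, ZMod.natCast_zmod_val]
        ring
      have hfi' : f i' j = s + (b : ZMod L) := by
        rw [hb, ZMod.natCast_zmod_val]
        ring
      have h0 : (((b : ℤ) + o i' - a - o i - z : ℤ) : ZMod L) = 0 := by
        rw [shiftBy, shiftBy, Pi.add_apply, Pi.add_apply, Pi.single_eq_same, Pi.single_eq_same,
          hfi, hfi'] at h
        push_cast
        linear_combination h
      rw [ZMod.intCast_zmod_eq_zero_iff_dvd] at h0
      have hz' := abs_le.1 hz
      have h1 := hfH i'
      have h2 := hoK i'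
      have := Int.le_of_dvd (by omega) h0
      omega
    intro u v hu hv huv
    obtain ⟨i, rfl⟩ := configOf_eq_true.1 hu
    obtain ⟨i', rfl⟩ := configOf_eq_true.1 hv
    refine ⟨j, fun z hz h => ?_⟩
    rcases lt_trichotomy i i' with hlt | heq | hlt
    · refine key i i' hlt (-z) (by rwa [abs_neg]) ?_
      push_cast
      rw [← h]
      ring
    · exact huv (by rw [heq])
    · exact key i' i hlt z hz h
  · intro P q M hq hP T
    have := pow_mul_le_of_isMove hL2 hfinj hfadj hfmono hq hP homono hoL T
    rwa [hfx] at this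

/-! ### Combining the estimates -/

theorem energy_le {V : Type*} [Fintype V] {g : V → V → ℝ} {η : ℝ} {x : V → Bool}
    (h : ∀ u v, x u = true → x v = true → u ≠ v → g u v ≤ η) (hη : 0 ≤ η) :
    energy g x ≤ (numParticles x : ℝ) ^ 2 * η := by
  have h1 : ∀ u v, (if x u = true ∧ x v = true ∧ u ≠ v then g u v else 0) ≤
      if x u = true then (if x v = true then η else 0) else 0 := by
    intro u v
    split_ifs with h₁ h₂ h₃ h₂ h₃
    exacts [h u v h₁.1 h₁.2.1 h₁.2.2, absurd h₁.2.1 h₃, absurd h₁.1 h₂, hη, le_rfl, le_rfl]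
  refine (Finset.sum_le_sum fun u _ => Finset.sum_le_sum fun v _ => h1 u v).trans (le_of_eq ?_)
  have h2 : ∀ a : ℝ, ∑ v, (if x v = true then a else 0) = numParticles x * a := by
    intro a
    rw [← Finset.sum_filter, Finset.sum_const, nsmul_eq_mul, numParticles]
  calc _ = ∑ u, if x u = true then numParticles x * η else 0 := by
        refine Finset.sum_congr rfl fun u _ => ?_
        split_ifs
        · exact h2 η
        · simp
    _ = _ := by rw [h2]; ring

theorem exists_time {ε : ℝ} (hε : 0 < ε) {n m : ℕ} (hn : 1 ≤ n) (h₁ : 4 * m ≤ ε * n)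
    (h₂ : 4 ≤ ε * n) :
    ∃ T : ℕ, T + m * (n + n ^ 2) = ⌊ε * (n : ℝ) ^ 3⌋₊ ∧ ε * n ^ 3 / 2 ≤ (T : ℝ) + 1 ∧
      (T : ℝ) ≤ ε * n ^ 3 ∧ (n : ℝ) ^ 2 ≤ ((T : ℝ) + 1) / 2 := by
  have hn1 : (1 : ℝ) ≤ n := by exact_mod_cast hn
  have hM : ((m * (n + n ^ 2) : ℕ) : ℝ) ≤ ε * n ^ 3 / 2 := by
    have h1 : (n : ℝ) + n ^ 2 ≤ 2 * n ^ 2 := by nlinarith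
    have h2 := mul_le_mul_of_nonneg_right h₁ (sq_nonneg (n : ℝ))
    have h3 := mul_le_mul_of_nonneg_left h1 (Nat.cast_nonneg m : (0 : ℝ) ≤ m)
    push_cast
    nlinarith
  have hfloor : m * (n + n ^ 2) ≤ ⌊ε * (n : ℝ) ^ 3⌋₊ :=
    Nat.le_floor (hM.trans (half_le_self (by positivity)))
  obtain ⟨T, hT⟩ := Nat.exists_eq_add_of_le' hfloor
  have hTR : (⌊ε * (n : ℝ) ^ 3⌋₊ : ℝ) = T + (m * (n + n ^ 2) : ℕ) := by exact_mod_cast hT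
  have h1 := (Nat.lt_floor_add_one (ε * (n : ℝ) ^ 3)).le
  have h2 := Nat.floor_le (by positivity : 0 ≤ ε * (n : ℝ) ^ 3)
  have h3 : (0 : ℝ) ≤ (m * (n + n ^ 2) : ℕ) := Nat.cast_nonneg _
  have h4 := mul_le_mul_of_nonneg_right h₂ (sq_nonneg (n : ℝ))
  refine ⟨T, hT.symm, by linarith, by linarith, ?_⟩
  have h5 : ε * n * (n : ℝ) ^ 2 = ε * n ^ 3 := by ring
  linarith

theorem le_occupationProb_of_moves {V : Type*} [Fintype V] [Nonempty V] {G : SimpleGraph V}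
    {g : V → V → ℝ} {B l : ℝ} (hg : IsInteraction G g B (l / Fintype.card V)) {D K k : ℕ}
    (hD : ∀ v, (Finset.univ.filter (G.Adj v)).card ≤ D) (hk : k ≤ K) {c ε q : ℝ} (hc : 0 < c)
    (hn₁ : 2 * c ≤ Fintype.card V) (hn₂ : 2 * (K * D * c) ≤ Fintype.card V)
    (hn₃ : 2 * (((K : ℝ) + 1) * D) ≤ Fintype.card V) (hε : 0 < ε)
    (hCε : c * (K * (D * (c * ((K + 1) * D) + 1) + K * l / B)) * ε ≤ 1 / 4) (hq₀ : 0 ≤ q)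
    (hq₁ : q ≤ 1)
    (hq : q ≤ c * Real.exp (-(2 * (K * D * c))) * (1 / 2 * Real.exp (-(2 * ((K + 1) * D)))))
    {m M : ℕ} (hm : m ≤ M) (hn₄ : 4 * M ≤ ε * Fintype.card V) (hn₅ : 4 ≤ ε * Fintype.card V)
    {x y : V → Bool} (hy : y ∈ OmegaK G k) (hE : energy g y ≤ B / 2)
    (hxy : ∀ (P : ℕ → (V → Bool) → ℝ) (q : ℝ) (s : ℕ), 0 ≤ q →
      (∀ x y v w, IsMove G k x y v w → ∀ T, q * P T y ≤ P (T + s) x) →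
      ∀ T, q ^ m * P T y ≤ P (T + m * s) x) :
    q ^ M * (1 / 4) ≤ occupationProb (kcipKernel G (c / Fintype.card V)) (OmegaK G k)
      ⌊ε * (Fintype.card V : ℝ) ^ 3⌋₊ (ε / 4 * (Fintype.card V : ℝ) ^ 3) x := by
  have hn1 : (1 : ℝ) ≤ Fintype.card V := by
    exact_mod_cast (Fintype.card_pos : 0 < Fintype.card V)
  have hn0 : (0 : ℝ) < Fintype.card V := by linarith
  obtain ⟨T, hTM, hT₁, hT₂, hb⟩ := exists_time hε Fintype.card_pos hn₄ hn₅
  have hnonneg := kcipKernel_nonneg G (p := c / Fintype.card V) (by positivity)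
    (by rw [div_le_one hn0]; linarith)
  have hend : 1 / 4 ≤ occupationProb (kcipKernel G (c / Fintype.card V)) (OmegaK G k) T
      (ε / 4 * (Fintype.card V : ℝ) ^ 3) y := by
    have h1 := le_occupationProb_of_energy hg hD hk hc hn₁ hb hy T
    refine le_trans ?_ (h1.trans (occupationProb_anti hnonneg _ T (by linarith) y))
    have h2 : energy g y / B ≤ 1 / 2 := by
      rw [div_le_iff₀ hg.pos]
      linarith
    have h3 : c * (K * (D * (c * ((K + 1) * D) + 1) + K * l / B)) / (Fintype.card V : ℝ) ^ 3 * T ≤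
        1 / 4 := by
      have hl : 0 ≤ l := by
        have := mul_nonneg hg.nonneg_defect hn0.le
        rwa [div_mul_cancel₀ _ hn0.ne'] at this
      have hB := hg.pos
      refine (mul_le_mul_of_nonneg_left hT₂ (by positivity)).trans (le_trans (le_of_eq ?_) hCε)
      field_simp
    linarith
  calc q ^ M * (1 / 4) ≤ q ^ m * occupationProb (kcipKernel G (c / Fintype.card V)) (OmegaK G k) T
          (ε / 4 * (Fintype.card V : ℝ) ^ 3) y :=
        mul_le_mul (pow_le_pow_of_le_one hq₀ hq₁ hm) hend (by norm_num) (pow_nonneg hq₀ m)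
    _ ≤ occupationProb (kcipKernel G (c / Fintype.card V)) (OmegaK G k)
          (T + m * (Fintype.card V + Fintype.card V ^ 2)) (ε / 4 * (Fintype.card V : ℝ) ^ 3) x := by
        refine hxy (fun T x => occupationProb (kcipKernel G (c / Fintype.card V)) (OmegaK G k) T
          (ε / 4 * (Fintype.card V : ℝ) ^ 3) x) q _ hq₀ (fun x y v w h T => ?_) T
        simp only [← add_assoc]
        exact (mul_le_mul_of_nonneg_right hq (occupationProb_nonneg hnonneg _ _ _ _)).trans
          (occupationProb_move hD hk hc hn₁ hn₂ hn₃ h _ _ T)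
    _ ≤ occupationProb (kcipKernel G (c / Fintype.card V)) (OmegaK G k)
          (T + M * (Fintype.card V + Fintype.card V ^ 2)) (ε / 4 * (Fintype.card V : ℝ) ^ 3) x :=
        occupationProb_mono hnonneg (sum_kcipKernel G _) _ _ x
          (Nat.add_le_add_left (Nat.mul_le_mul_right _ hm) T)
    _ = _ := by rw [hTM]

theorem exists_le_occupationProb_torus {c : ℝ} (hc : 0 < c) {d : ℕ} (hd : 3 ≤ d) {K : ℕ}
    (hK : 1 ≤ K) :
    ∃ ε δ α : ℝ, 0 < ε ∧ 0 < δ ∧ 0 < α ∧ ∃ N : ℕ, ∀ (L : ℕ) [NeZero L], N < L ^ d →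
      ∀ k ≤ K, ∀ x ∈ OmegaK (torusGraph L d) k,
        δ ≤ occupationProb
          (kcipKernel (torusGraph L d) (c / Fintype.card (Fin d → ZMod L)))
          (OmegaK (torusGraph L d) k) ⌊ε * (Fintype.card (Fin d → ZMod L) : ℝ) ^ 3⌋₊
          (α * (Fintype.card (Fin d → ZMod L) : ℝ) ^ 3) x := by
  have hd0 : 0 < d := by omega
  have hdR : (0 : ℝ) < d := by exact_mod_cast hd0
  have hKR : (0 : ℝ) < K := by exact_mod_cast hK
  set B : ℝ := 1 / (4 * d) ^ 2 with hB
  have hB0 : 0 < B := by positivity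
  set l : ℝ := 4 * d * (5 * d) ^ d with hl
  set D : ℕ := 2 * d with hD
  set η : ℝ := B / (2 * K ^ 2) with hη
  have hη0 : 0 < η := by positivity
  obtain ⟨R, hR⟩ := exists_torusGreen_le hd hη0
  set C : ℝ := c * (K * (D * (c * ((K + 1) * D) + 1) + K * l / B)) with hC
  have hC0 : 0 ≤ C := by positivity
  set ε : ℝ := 1 / (4 * (C + 1)) with hε
  have hε0 : 0 < ε := by positivity
  have hCε : C * ε ≤ 1 / 4 := by
    rw [hε, mul_one_div, div_le_div_iff₀ (by positivity) (by norm_num)]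
    linarith
  set m₀ : ℕ := K * (K * (R + 1)) with hm₀
  set q : ℝ := min (c * Real.exp (-(2 * (K * D * c))) * (1 / 2 * Real.exp (-(2 * ((K + 1) * D))))) 1
    with hq
  have hq0 : 0 < q := lt_min (by positivity) one_pos
  have hq1 : q ≤ 1 := min_le_right _ _
  set A : ℕ := (K + 1) * ((K + 1) * (R + 1) + 1) + 3 with hA
  set r : ℝ := 2 * c + 2 * (K * D * c) + 2 * (((K : ℝ) + 1) * D) + 4 * m₀ / ε + 4 / ε with hr
  refine ⟨ε, q ^ m₀ * (1 / 4), ε / 4, hε0, by positivity, by positivity, ⌈r⌉₊ + A ^ d, ?_⟩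
  intro L _ hN k hk x hx
  have hcard : Fintype.card (Fin d → ZMod L) = L ^ d := by
    rw [Fintype.card_pi, Finset.prod_const, Finset.card_univ, Fintype.card_fin, ZMod.card]
  set n := Fintype.card (Fin d → ZMod L) with hn
  have hAL : A < L := lt_of_pow_lt_pow_left₀ d (Nat.zero_le _) (by omega)
  have hrn : r ≤ n := (Nat.le_ceil r).trans (by rw [hcard]; exact_mod_cast (by omega))
  have t₁ : 0 ≤ 2 * (K * D * c) := by positivity
  have t₂ : 0 ≤ 2 * (((K : ℝ) + 1) * D) := by positivity
  have t₃ : 0 ≤ 4 * m₀ / ε := by positivity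
  have t₄ : 0 ≤ 4 / ε := by positivity
  have hn₁ : 2 * c ≤ n := by linarith
  have hn₂ : 2 * (K * D * c) ≤ n := by linarith
  have hn₃ : 2 * (((K : ℝ) + 1) * D) ≤ n := by linarith
  have hn₄ : 4 * m₀ ≤ ε * n := by
    rw [mul_comm ε, ← div_le_iff₀ hε0]
    linarith
  have hn₅ : 4 ≤ ε * n := by
    rw [mul_comm ε, ← div_le_iff₀ hε0]
    linarith
  have hdeg : ∀ v, (Finset.univ.filter ((torusGraph L d).Adj v)).card ≤ D := fun v =>
    (card_torusGraph_adj (by omega) v).le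
  obtain ⟨y, m, hy, hm, hsep, hpath⟩ := exists_spread hd0 hk (R := R) (by omega) hx
  have hE : energy (torusGreen L d) y ≤ B / 2 := by
    refine (energy_le (η := η) (fun u v hu hv huv => ?_) hη0.le).trans ?_
    · obtain ⟨j, hj⟩ := hsep u v hu hv huv
      exact hR L u v j hj
    · have hyK : ((numParticles y : ℕ) : ℝ) ≤ K := by
        rw [hy.1]
        exact_mod_cast hk
      calc ((numParticles y : ℕ) : ℝ) ^ 2 * η ≤ K ^ 2 * η := by gcongr
        _ = B / 2 := by rw [hη]; field_simp
  convert le_occupationProb_of_moves (isInteraction_torusGreen (L := L) (by omega) hd0) hdeg hk hc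
    hn₁ hn₂ hn₃ hε0 hCε hq0.le hq1 (min_le_left _ _) hm hn₄ hn₅ hy hE hpath

/-- Fix `0 < c`, `d ≥ 3` and `K ≥ 1`. There exist `ε, δ, α > 0` depending
only on `c, d, K` such that for all `n = (L+1)^d` sufficiently large, for the KCIP on
`Λ(L+1,d)` with `p = c/n`, uniformly over `1 ≤ k ≤ K` and initial configurations `x ∈ Ω_k`:
`P[Σ_{t=0}^{⌊εn³⌋} 1{X_t ∈ Ω_k} ≥ α n³ | X_0 = x] ≥ δ`. -/
theorem kcip_occupation_in_OmegaK (c : ℝ) (hc : 0 < c) (d : ℕ) (hd : 3 ≤ d)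
    (K : ℕ) (hK : 1 ≤ K) :
    ∃ ε δ α : ℝ, 0 < ε ∧ 0 < δ ∧ 0 < α ∧ ∃ N : ℕ,
      ∀ L : ℕ, N < (L + 1) ^ d →
      ∀ k : ℕ, 1 ≤ k → k ≤ K →
      ∀ x : (Fin d → ZMod (L + 1)) → Bool, x ∈ OmegaK (torusGraph (L + 1) d) k →
        trajProb (kcipKernel (torusGraph (L + 1) d) (c / (((L + 1) ^ d : ℕ) : ℝ))) x
            (⌊ε * (((L + 1) ^ d : ℕ) : ℝ) ^ 3⌋₊)
            (fun ω =>
              α * (((L + 1) ^ d : ℕ) : ℝ) ^ 3 ≤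
                ∑ t : Fin (⌊ε * (((L + 1) ^ d : ℕ) : ℝ) ^ 3⌋₊ + 1),
                  if ω t ∈ OmegaK (torusGraph (L + 1) d) k then (1 : ℝ) else 0) ≥
          δ := by
  obtain ⟨ε, δ, α, hε, hδ, hα, N, h⟩ := exists_le_occupationProb_torus hc hd hK
  refine ⟨ε, δ, α, hε, hδ, hα, N, fun L hN k _ hk x hx => ?_⟩
  have hcard : Fintype.card (Fin d → ZMod (L + 1)) = (L + 1) ^ d := by
    rw [Fintype.card_pi, Finset.prod_const, Finset.card_univ, Fintype.card_fin, ZMod.card]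
  have := h (L + 1) hN k hk x hx
  rw [hcard] at this
  exact this
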